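/- A distribution p(x_V) obeys the global nested Markov property with respect to an ADMG 𝒢(V) if and only if p(x_V) obeys the ordered local nested Markov property for 𝒢(V) and a topological ordering ≺. -/

import Mathlib

open scoped Classical
open Finset

namespace Nested

/-- A directed mixed graph: directed (`dir`) and bidirected (`bi`) edges. -/
structure MixedGraph (Vt : Type) where
  dir : Vt → Vt → Prop
  bi : Vt → Vt → Prop

/-- A step along a path: an edge traversed from `src` to `tgt`, with Booleans
recording whether there is an arrowhead at the `src` (resp. `tgt`) end. -/
structure Step (Vt : Type) where
  src : Vt
  tgt : Vt
  hsrc : Bool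
  htgt : Bool

/-- The step corresponds to an actual edge of the mixed graph `M`. -/
def StepIn {Vt : Type} (M : MixedGraph Vt) (s : Step Vt) : Prop :=
  (s.hsrc = false ∧ s.htgt = true ∧ M.dir s.src s.tgt) ∨
  (s.hsrc = true ∧ s.htgt = false ∧ M.dir s.tgt s.src) ∨
  (s.hsrc = true ∧ s.htgt = true ∧ M.bi s.src s.tgt)

/-- `IsWalk M a p b`: `p` is a walk in `M` from `a` to `b`. -/
def IsWalk {Vt : Type} (M : MixedGraph Vt) : Vt → List (Step Vt) → Vt → Prop
  | a, [], b => a = b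
  | a, s :: p, b => s.src = a ∧ StepIn M s ∧ IsWalk M s.tgt p b

/-- The list of vertices visited by a walk starting at `a`. -/
def wverts {Vt : Type} (a : Vt) (p : List (Step Vt)) : List Vt :=
  a :: p.map Step.tgt

/-- The non-endpoint (interior) vertices of a walk. -/
def interiorVerts {Vt : Type} (p : List (Step Vt)) : List Vt :=
  (p.map Step.tgt).dropLast

variable {Vt : Type} [Fintype Vt] [DecidableEq Vt]

/-- `z` is an ancestor (via directed edges) of some element of `C`. -/
def ancOf (M : MixedGraph Vt) (C : Finset Vt) (z : Vt) : Prop :=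
  ∃ c ∈ C, Relation.ReflTransGen M.dir z c

/-- The common vertex of two consecutive steps is a collider. -/
def Collider {Vt : Type} (s t : Step Vt) : Prop := s.htgt = true ∧ t.hsrc = true

/-- The interior vertex shared by consecutive steps `s`, `t` satisfies the
m-connection requirement given `C`: colliders are ancestors of `C`,
non-colliders lie outside `C`. -/
def jointOK (M : MixedGraph Vt) (C : Finset Vt) (s t : Step Vt) : Prop :=
  (Collider s t ∧ ancOf M C s.tgt) ∨ (¬ Collider s t ∧ s.tgt ∉ C)

/-- `a` and `b` are m-connected given `C` in `M`: there is a path (walk with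
distinct vertices) from `a` to `b` every non-collider of which avoids `C` and
every collider of which is an ancestor of `C`. -/
def MConn (M : MixedGraph Vt) (C : Finset Vt) (a b : Vt) : Prop :=
  ∃ p : List (Step Vt), IsWalk M a p b ∧ (wverts a p).Nodup ∧
    List.Chain' (jointOK M C) p

/-- m-separation of the sets `A` and `B` given `C` in `M`. -/
def MSep (M : MixedGraph Vt) (A B C : Finset Vt) : Prop :=
  ∀ a ∈ A, ∀ b ∈ B, ¬ MConn M C a b

/-- There is a directed path from `v` to `w` in `M` all of whose
non-endpoint vertices lie in `L`. -/
def DirVia (M : MixedGraph Vt) (L : Finset Vt) (v w : Vt) : Prop :=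
  ∃ p : List (Step Vt), p ≠ [] ∧ IsWalk M v p w ∧ (wverts v p).Nodup ∧
    (∀ s ∈ p, s.hsrc = false ∧ s.htgt = true) ∧
    (∀ z ∈ interiorVerts p, z ∈ L)

/-- There is a path between `v` and `w` in `M` with arrowheads at both
endpoints, all of whose non-endpoint vertices are non-colliders lying in `L`. -/
def BiVia (M : MixedGraph Vt) (L : Finset Vt) (v w : Vt) : Prop :=
  ∃ p : List (Step Vt), p ≠ [] ∧ IsWalk M v p w ∧ (wverts v p).Nodup ∧
    (∀ s, p.head? = some s → s.hsrc = true) ∧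
    (∀ s, p.getLast? = some s → s.htgt = true) ∧
    (∀ z ∈ interiorVerts p, z ∈ L) ∧
    List.Chain' (fun s t => ¬ Collider s t) p

/-- A (pre-)conditional acyclic directed mixed graph: a mixed graph together
with disjoint finite sets `V` of random and `W` of fixed vertices.  The
well-formedness conditions are collected in `PreCADMG.WF`. -/
structure PreCADMG (Vt : Type) where
  dir : Vt → Vt → Prop
  bi : Vt → Vt → Prop
  V : Finset Vt
  W : Finset Vt

/-- The underlying mixed graph of a CADMG. -/
def PreCADMG.mg {Vt : Type} (G : PreCADMG Vt) : MixedGraph Vt := ⟨G.dir, G.bi⟩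

/-- Well-formedness: `V` and `W` are disjoint, `bi` is symmetric, all edges
join vertices of `V ∪ W`, directed and bidirected edges never point into `W`,
and there are no directed cycles.  (So `WF` with `W = ∅` says: ADMG.) -/
def PreCADMG.WF {Vt : Type} (G : PreCADMG Vt) : Prop :=
  Disjoint G.V G.W ∧
  (∀ a b, G.bi a b → G.bi b a) ∧
  (∀ a b, G.dir a b → a ∈ G.V ∪ G.W ∧ b ∈ G.V) ∧
  (∀ a b, G.bi a b → a ∈ G.V ∧ b ∈ G.V) ∧
  (∀ v, ¬ Relation.TransGen G.dir v v)

/-- The district of `v`: random vertices joined to `v` by a bidirected path. -/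
noncomputable def dis (G : PreCADMG Vt) (v : Vt) : Finset Vt :=
  G.V.filter (fun w => Relation.ReflTransGen G.bi v w)

/-- The set of districts of `G`. -/
noncomputable def districts (G : PreCADMG Vt) : Finset (Finset Vt) :=
  G.V.image (dis G)

/-- Descendants of `v` (including `v` itself, among the vertices of `G`). -/
noncomputable def deF (G : PreCADMG Vt) (v : Vt) : Finset Vt :=
  (G.V ∪ G.W).filter (fun w => Relation.ReflTransGen G.dir v w)

/-- Non-descendants of `v`. -/
noncomputable def ndF (G : PreCADMG Vt) (v : Vt) : Finset Vt :=
  (G.V ∪ G.W) \ deF G v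

/-- Ancestors of the set `D` (including `D`). -/
noncomputable def anS (G : PreCADMG Vt) (D : Finset Vt) : Finset Vt :=
  (G.V ∪ G.W).filter (fun a => ∃ d ∈ D, Relation.ReflTransGen G.dir a d)

/-- Parents of the set `D`. -/
noncomputable def paS (G : PreCADMG Vt) (D : Finset Vt) : Finset Vt :=
  (G.V ∪ G.W).filter (fun a => ∃ d ∈ D, G.dir a d)

/-- Markov blanket: `mb(t) = pa(dis(t)) ∪ (dis(t) \ {t})`. -/
noncomputable def mb (G : PreCADMG Vt) (t : Vt) : Finset Vt :=
  paS G (dis G t) ∪ (dis G t).erase t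

/-- `v` is fixable in `G`: `v` is random and `dis(v) ∩ de(v) = {v}`. -/
def fixable (G : PreCADMG Vt) (v : Vt) : Prop :=
  v ∈ G.V ∧ dis G v ∩ deF G v = {v}

/-- The set `𝔽(G)` of fixable vertices. -/
noncomputable def FixF (G : PreCADMG Vt) : Finset Vt :=
  G.V.filter (fun v => fixable G v)

/-- The graph `φ_r(G)`:  `r` becomes fixed and edges with an arrowhead at `r`
are deleted. -/
def fixG (G : PreCADMG Vt) (r : Vt) : PreCADMG Vt where
  dir a b := G.dir a b ∧ b ≠ r
  bi a b := G.bi a b ∧ a ≠ r ∧ b ≠ r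
  V := G.V.erase r
  W := insert r G.W

/-- The induced subgraph on `A`, preserving random/fixed status. -/
def induce (G : PreCADMG Vt) (A : Finset Vt) : PreCADMG Vt where
  dir a b := G.dir a b ∧ a ∈ A ∧ b ∈ A
  bi a b := G.bi a b ∧ a ∈ A ∧ b ∈ A
  V := G.V ∩ A
  W := G.W ∩ A

/-- `A` is an ancestral set in `G`. -/
def Ancestral (G : PreCADMG Vt) (A : Finset Vt) : Prop :=
  A ⊆ G.V ∪ G.W ∧
  ∀ a ∈ A, ∀ b ∈ G.V ∪ G.W, Relation.ReflTransGen G.dir b a → b ∈ A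

/-- `ord` is (the rank function of) a topological total ordering for `G`:
if `a ≺ b` then `a` is not a descendant of `b`. -/
def IsTopo (G : PreCADMG Vt) (ord : Vt → ℕ) : Prop :=
  Function.Injective ord ∧
  ∀ a b, ord a < ord b → ¬ Relation.ReflTransGen G.dir b a

/-- The predecessors of `d` in the ordering `ord`. -/
noncomputable def preF (G : PreCADMG Vt) (ord : Vt → ℕ) (d : Vt) : Finset Vt :=
  (G.V ∪ G.W).filter (fun a => ord a < ord d)

/-- The graph `G^{|W}`: all pairs of fixed vertices joined by bidirected
edges. -/
def augMG (G : PreCADMG Vt) : MixedGraph Vt :=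
  ⟨G.dir, fun a b => G.bi a b ∨ (a ∈ G.W ∧ b ∈ G.W ∧ a ≠ b)⟩

/-- Adjacency in the augmented graph `(G)^a`: joined in `G^{|W}` by a path on
which every non-endpoint vertex is a collider. -/
def augEdge (G : PreCADMG Vt) (a b : Vt) : Prop :=
  a ≠ b ∧ ∃ p : List (Step Vt), p ≠ [] ∧ IsWalk (augMG G) a p b ∧
    (wverts a p).Nodup ∧ List.Chain' Collider p

/-- Undirected separation of `a` from `b` by `C` (w.r.t. adjacency `E`). -/
def USepPt (E : Vt → Vt → Prop) (C : Finset Vt) (a b : Vt) : Prop :=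
  ∀ l : List Vt, l.Chain' E → l.head? = some a → l.getLast? = some b →
    l.Nodup → ∃ v ∈ l, v ∈ C

/-- Undirected separation of `A` from `B` by `C`. -/
def USep (E : Vt → Vt → Prop) (C A B : Finset Vt) : Prop :=
  ∀ a ∈ A, ∀ b ∈ B, USepPt E C a b

/-- The latent projection of `G` obtained by projecting out the (random)
vertices in `H`. -/
def project (G : PreCADMG Vt) (H : Finset Vt) : PreCADMG Vt where
  dir v w := v ∈ (G.V \ H) ∪ G.W ∧ w ∈ G.V \ H ∧ v ≠ w ∧ DirVia G.mg H v w
  bi v w := v ∈ G.V \ H ∧ w ∈ G.V \ H ∧ v ≠ w ∧ BiVia G.mg H v w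
  V := G.V \ H
  W := G.W

/-! ## Kernels -/

variable {𝔛 : Vt → Type} [∀ v, Fintype (𝔛 v)]

/-- Sum a function of a joint state over all assignments to the coordinates in
`S`, the remaining coordinates being given by `x`. -/
noncomputable def sumOver (S : Finset Vt) (f : (∀ v, 𝔛 v) → ℝ) (x : ∀ v, 𝔛 v) : ℝ :=
  ∑ y : ((v : {v : Vt // v ∈ S}) → 𝔛 v.1),
    f (fun v => if h : v ∈ S then y ⟨v, h⟩ else x v)

/-- `f` depends only on the coordinates in `S`. -/
def DepOn (f : (∀ v, 𝔛 v) → ℝ) (S : Finset Vt) : Prop :=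
  ∀ x y : ∀ v, 𝔛 v, (∀ v ∈ S, x v = y v) → f x = f y

/-- `q` is a kernel `q_V(x_V | x_W)`: a nonnegative function of `(x_V, x_W)`
with `∑_{x_V} q_V(x_V | x_W) = 1` for every `x_W`. -/
def IsKernel (V W : Finset Vt) (q : (∀ v, 𝔛 v) → ℝ) : Prop :=
  (∀ x, 0 ≤ q x) ∧ DepOn q (V ∪ W) ∧ ∀ x, sumOver V q x = 1

/-- Case (a) of the definition of kernel conditional independence
`X_A ⫫ X_B | X_C [q_V]`:  `A ∩ W = ∅` and the conditional kernel
`q_V(x_A | x_B, x_C, x_{W∖(B∪C)})` is, wherever defined, a function of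
`x_A, x_C` only. -/
def KIndepA (V W : Finset Vt) (q : (∀ v, 𝔛 v) → ℝ) (A B C : Finset Vt) : Prop :=
  A ∩ W = ∅ ∧
  ∀ x y : ∀ v, 𝔛 v, (∀ v ∈ A ∪ C, x v = y v) →
    0 < sumOver (V \ (B ∪ C)) q x → 0 < sumOver (V \ (B ∪ C)) q y →
    sumOver (V \ (A ∪ B ∪ C)) q x / sumOver (V \ (B ∪ C)) q x =
      sumOver (V \ (A ∪ B ∪ C)) q y / sumOver (V \ (B ∪ C)) q y

/-- Kernel conditional independence `X_A ⫫ X_B | X_C [q_V]`. -/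
def KIndep (V W : Finset Vt) (q : (∀ v, 𝔛 v) → ℝ) (A B C : Finset Vt) : Prop :=
  KIndepA V W q A B C ∨ KIndepA V W q B A C

/-- The conditional kernel `q_V(x_d | x_T)` (as a function of the joint
state). -/
noncomputable def condOn (V : Finset Vt) (q : (∀ v, 𝔛 v) → ℝ) (d : Vt)
    (T : Finset Vt) : (∀ v, 𝔛 v) → ℝ :=
  fun x => sumOver (V \ insert d T) q x / sumOver (V \ T) q x

/-- The kernel `q*_{V∖H} = q_V / q_V(x_H | x_T, x_W)` obtained by fixing `H`. -/
noncomputable def qstar (V H T : Finset Vt) (q : (∀ v, 𝔛 v) → ℝ) :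
    (∀ v, 𝔛 v) → ℝ :=
  fun x => q x / (sumOver (V \ (H ∪ T)) q x / sumOver (V \ T) q x)

/-- The kernel fixing operation `φ_r(q; G) = q / q_V(x_r | x_{mb_G(r)})`. -/
noncomputable def fixK (G : PreCADMG Vt) (r : Vt) (q : (∀ v, 𝔛 v) → ℝ) :
    (∀ v, 𝔛 v) → ℝ :=
  fun x => q x / condOn G.V q r (mb G r) x

/-- The global Markov property for a CADMG (`q ∈ 𝒫^c_m(G)`). -/
def Pcm (G : PreCADMG Vt) (q : (∀ v, 𝔛 v) → ℝ) : Prop :=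
  ∀ A B C : Finset Vt, A ⊆ G.V ∪ G.W → B ⊆ G.V ∪ G.W → C ⊆ G.V ∪ G.W →
    Disjoint A B → Disjoint A C → Disjoint B C →
    MSep (augMG G) A B C → KIndep G.V G.W q A B C

/-- The augmented Markov property for a CADMG (`q ∈ 𝒫^c_a(G)`). -/
def Pca (G : PreCADMG Vt) (q : (∀ v, 𝔛 v) → ℝ) : Prop :=
  ∀ A B C : Finset Vt, A ⊆ G.V ∪ G.W → B ⊆ G.V ∪ G.W → C ⊆ G.V ∪ G.W →
    Disjoint A B → Disjoint A C → Disjoint B C →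
    USep (augEdge (induce G (anS G (A ∪ B ∪ C)))) C A B →
    KIndep G.V G.W q A B C

/-- The local Markov property for `G` at `t`. -/
def LocalAt (G : PreCADMG Vt) (q : (∀ v, 𝔛 v) → ℝ) (t : Vt) : Prop :=
  KIndep G.V G.W q {t} ((G.V ∪ G.W) \ insert t (mb G t)) (mb G t)

/-- The ordered local Markov property for a CADMG (`q ∈ 𝒫^c_l(G, ≺)`). -/
def Pcl (G : PreCADMG Vt) (ord : Vt → ℕ) (q : (∀ v, 𝔛 v) → ℝ) : Prop :=
  ∀ A : Finset Vt, Ancestral G A → ∀ m ∈ A, (∀ a ∈ A, ord a ≤ ord m) →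
    m ∈ G.V →
    LocalAt (induce G ((G.V ∩ A) ∪ G.W)) (sumOver (G.V \ A) q) m

/-- Tian factorization for a CADMG (`q ∈ 𝒫^c_f(G)`). -/
def Pcf (G : PreCADMG Vt) (q : (∀ v, 𝔛 v) → ℝ) : Prop :=
  ∀ A : Finset Vt, Ancestral G A →
    ∃ f : Finset Vt → ((∀ v, 𝔛 v) → ℝ),
      (∀ D ∈ districts (induce G A), IsKernel D (paS G D \ D) (f D)) ∧
      ∀ x, sumOver (G.V \ A) q x = ∏ D ∈ districts (induce G A), f D x

/-- `T^{(d,D)}_≺ = mb_G(d, an_G(D) ∩ pre_≺(d))`. -/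
noncomputable def Tset (G : PreCADMG Vt) (ord : Vt → ℕ) (d : Vt)
    (D : Finset Vt) : Finset Vt :=
  mb (induce G (insert d (anS G D ∩ preF G ord d))) d

/-- The district kernel
`q_D(x_D | x_{pa(D)∖D}) = ∏_{d ∈ D} q_V(x_d | x_{T^{(d,D)}_≺})`. -/
noncomputable def qD (G : PreCADMG Vt) (ord : Vt → ℕ)
    (q : (∀ v, 𝔛 v) → ℝ) (D : Finset Vt) : (∀ v, 𝔛 v) → ℝ :=
  fun x => ∏ d ∈ D, condOn G.V q d (Tset G ord d D) x

/-! ## Fixing sequences and nested Markov properties -/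

/-- Iterated graph fixing. -/
def fixGs : PreCADMG Vt → List Vt → PreCADMG Vt
  | G, [] => G
  | G, r :: rs => fixGs (fixG G r) rs

/-- Iterated kernel fixing. -/
noncomputable def fixKs : PreCADMG Vt → ((∀ v, 𝔛 v) → ℝ) → List Vt →
    ((∀ v, 𝔛 v) → ℝ)
  | _, q, [] => q
  | G, q, r :: rs => fixKs (fixG G r) (fixK G r q) rs

/-- A valid fixing sequence: each vertex is fixable when its turn comes. -/
def ValidSeq : PreCADMG Vt → List Vt → Prop
  | _, [] => True
  | G, r :: rs => fixable G r ∧ ValidSeq (fixG G r) rs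

/-- The global nested Markov property for an ADMG. -/
def NestedGlobal (G : PreCADMG Vt) (p : (∀ v, 𝔛 v) → ℝ) : Prop :=
  ∀ ws : List Vt, ValidSeq G ws → Pcm (fixGs G ws) (fixKs G p ws)

/-- `C` is intrinsic in `G`: a district of a reachable CADMG. -/
def Intrinsic (G : PreCADMG Vt) (C : Finset Vt) : Prop :=
  ∃ ws : List Vt, ws.Nodup ∧ ValidSeq G ws ∧ C ∈ districts (fixGs G ws)

/-- The ordered local nested Markov property for an ADMG. -/
def NestedLocal (G : PreCADMG Vt) (ord : Vt → ℕ) (p : (∀ v, 𝔛 v) → ℝ) : Prop :=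
  ∀ C : Finset Vt, Intrinsic G C →
    ∀ ws : List Vt, ws.Nodup → ValidSeq G ws → ws.toFinset = G.V \ C →
      ∀ m ∈ C, (∀ c ∈ C, ord c ≤ ord m) →
        LocalAt (fixGs G ws) (fixKs G p ws) m

end Nested

set_option linter.unusedSectionVars false

namespace Nested

section Sums

variable {Vt : Type} [Fintype Vt] [DecidableEq Vt] {𝔛 : Vt → Type}

lemma DepOn.mono {f : (∀ v, 𝔛 v) → ℝ} {S T : Finset Vt} (h : DepOn f S) (hST : S ⊆ T) :
    DepOn f T :=
  fun x y hxy => h x y fun v hv => hxy v (hST hv)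

lemma DepOn.div {f g : (∀ v, 𝔛 v) → ℝ} {S : Finset Vt} (hf : DepOn f S) (hg : DepOn g S) :
    DepOn (fun x => f x / g x) S :=
  fun x y hxy => congrArg₂ (· / ·) (hf x y hxy) (hg x y hxy)

lemma DepOn.prod {ι : Type} {s : Finset ι} {f : ι → (∀ v, 𝔛 v) → ℝ} {S : Finset Vt}
    (hf : ∀ i ∈ s, DepOn (f i) S) : DepOn (fun x => ∏ i ∈ s, f i x) S :=
  fun x y hxy => Finset.prod_congr rfl fun i hi => hf i hi x y hxy

lemma DepOn.update_eq {f : (∀ v, 𝔛 v) → ℝ} {S : Finset Vt} (hf : DepOn f S) {t : Vt}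
    (ht : t ∉ S) (x : ∀ v, 𝔛 v) (a : 𝔛 t) : f (Function.update x t a) = f x :=
  hf _ _ fun _ hv => Function.update_of_ne (ne_of_mem_of_not_mem hv ht) _ _

variable [∀ v, Fintype (𝔛 v)]

lemma sumOver_eq_sum_filter (S : Finset Vt) (f : (∀ v, 𝔛 v) → ℝ) (x : ∀ v, 𝔛 v) :
    sumOver S f x =
      ∑ z ∈ univ.filter (fun z : ∀ v, 𝔛 v => ∀ v, v ∉ S → z v = x v), f z := by
  unfold sumOver
  refine Finset.sum_bij (fun y _ v => if h : v ∈ S then y ⟨v, h⟩ else x v) ?_ ?_ ?_ ?_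
  · intro y _
    simp only [mem_filter, mem_univ, true_and]
    intro v hv
    simp [hv]
  · intro y _ y' _ h
    funext ⟨v, hv⟩
    simpa [hv] using congrFun h v
  · intro z hz
    simp only [mem_filter, mem_univ, true_and] at hz
    refine ⟨fun v => z v.1, mem_univ _, ?_⟩
    funext v
    by_cases hv : v ∈ S
    · simp [hv]
    · simp [hv, hz v hv]
  · intro y _
    rfl

@[simp]
lemma sumOver_empty (f : (∀ v, 𝔛 v) → ℝ) : sumOver ∅ f = f := by
  funext x
  rw [sumOver_eq_sum_filter]
  have : univ.filter (fun z : ∀ v, 𝔛 v => ∀ v, v ∉ (∅ : Finset Vt) → z v = x v) = {x} := by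
    ext z
    simp [funext_iff]
  rw [this, sum_singleton]

lemma sumOver_union {S T : Finset Vt} (hST : Disjoint S T) (f : (∀ v, 𝔛 v) → ℝ) :
    sumOver (S ∪ T) f = sumOver S (sumOver T f) := by
  funext x
  rw [sumOver_eq_sum_filter, sumOver_eq_sum_filter]
  simp only [sumOver_eq_sum_filter T]
  rw [Finset.sum_comm' (t' := univ.filter (fun z : ∀ v, 𝔛 v => ∀ v, v ∉ S ∪ T → z v = x v))
    (s' := fun z => {T.piecewise x z})]
  · simp
  · intro z z'
    simp only [mem_filter, mem_univ, true_and, mem_singleton, mem_union, not_or]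
    constructor
    · rintro ⟨h1, h2⟩
      refine ⟨?_, fun v hv => (h2 v hv.2).trans (h1 v hv.1)⟩
      funext v
      by_cases hv : v ∈ T
      · simp [hv, h1 v (Finset.disjoint_right.mp hST hv)]
      · simp [hv, h2 v hv]
    · rintro ⟨rfl, h2⟩
      refine ⟨fun v hv => ?_, fun v hv => by simp [hv]⟩
      by_cases hvT : v ∈ T
      · simp [hvT]
      · simp [hvT, h2 v ⟨hv, hvT⟩]

lemma sumOver_sdiff {S U : Finset Vt} (h : S ⊆ U) (f : (∀ v, 𝔛 v) → ℝ) :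
    sumOver (U \ S) (sumOver S f) = sumOver U f := by
  rw [← sumOver_union Finset.sdiff_disjoint, Finset.sdiff_union_of_subset h]

lemma DepOn.sumOver {f : (∀ v, 𝔛 v) → ℝ} {T : Finset Vt} (hf : DepOn f T) (S : Finset Vt) :
    DepOn (Nested.sumOver S f) (T \ S) := by
  intro x y hxy
  refine Finset.sum_congr rfl fun z _ => hf _ _ fun v hv => ?_
  by_cases hvS : v ∈ S
  · simp [hvS]
  · simp [hvS, hxy v (mem_sdiff.mpr ⟨hv, hvS⟩)]

lemma depOn_sumOver (f : (∀ v, 𝔛 v) → ℝ) (S : Finset Vt) : DepOn (sumOver S f) (univ \ S) :=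
  DepOn.sumOver (fun _ _ h => congrArg f (funext fun v => h v (mem_univ v))) S

lemma sumOver_mul_left {k : (∀ v, 𝔛 v) → ℝ} {R S : Finset Vt} (hk : DepOn k R)
    (hRS : Disjoint R S) (f : (∀ v, 𝔛 v) → ℝ) (x : ∀ v, 𝔛 v) :
    sumOver S (fun z => k z * f z) x = k x * sumOver S f x := by
  unfold sumOver
  rw [Finset.mul_sum]
  refine Finset.sum_congr rfl fun z _ => ?_
  refine congrArg (· * _) (hk _ _ fun v hv => ?_)
  simp [Finset.disjoint_left.mp hRS hv]

lemma sumOver_div {k : (∀ v, 𝔛 v) → ℝ} {R S : Finset Vt} (hk : DepOn k R)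
    (hRS : Disjoint R S) (f : (∀ v, 𝔛 v) → ℝ) (x : ∀ v, 𝔛 v) :
    sumOver S (fun z => f z / k z) x = sumOver S f x / k x := by
  have hk' : DepOn (fun z => (k z)⁻¹) R := fun x y h => congrArg _ (hk x y h)
  simpa only [div_eq_inv_mul] using sumOver_mul_left hk' hRS f x

lemma sumOver_nonneg {f : (∀ v, 𝔛 v) → ℝ} (hf : ∀ x, 0 ≤ f x) (S : Finset Vt)
    (x : ∀ v, 𝔛 v) : 0 ≤ sumOver S f x :=
  Finset.sum_nonneg fun _ _ => hf _

lemma le_sumOver {f : (∀ v, 𝔛 v) → ℝ} (hf : ∀ x, 0 ≤ f x) (S : Finset Vt)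
    (x : ∀ v, 𝔛 v) : f x ≤ sumOver S f x := by
  rw [sumOver_eq_sum_filter]
  exact Finset.single_le_sum (f := f) (fun z _ => hf z) (by simp)

lemma exists_pos_of_sumOver_pos {f : (∀ v, 𝔛 v) → ℝ} {S : Finset Vt}
    {x : ∀ v, 𝔛 v} (h : 0 < sumOver S f x) :
    ∃ z : ∀ v, 𝔛 v, (∀ v, v ∉ S → z v = x v) ∧ 0 < f z := by
  rw [sumOver_eq_sum_filter] at h
  obtain ⟨z, hz, hz'⟩ := Finset.exists_lt_of_sum_lt (f := fun _ => (0 : ℝ)) (by simpa using h)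
  exact ⟨z, by simpa using hz, hz'⟩

lemma condOn_pos {V : Finset Vt} {q : (∀ v, 𝔛 v) → ℝ} (hq : ∀ x, 0 ≤ q x) {x : ∀ v, 𝔛 v}
    (hx : 0 < q x) (r : Vt) (T : Finset Vt) : 0 < condOn V q r T x :=
  div_pos (hx.trans_le (le_sumOver hq _ x)) (hx.trans_le (le_sumOver hq _ x))

lemma depOn_condOn (V : Finset Vt) (q : (∀ v, 𝔛 v) → ℝ) (r : Vt) (T : Finset Vt) :
    DepOn (condOn V q r T) (univ \ (V \ insert r T)) := by
  refine DepOn.div (depOn_sumOver _ _) ((depOn_sumOver _ _).mono ?_)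
  exact sdiff_subset_sdiff subset_rfl (sdiff_subset_sdiff subset_rfl (subset_insert _ _))

lemma DepOn.condOn {V U : Finset Vt} {q : (∀ v, 𝔛 v) → ℝ} (hq : DepOn q U) (r : Vt)
    (T : Finset Vt) : DepOn (Nested.condOn V q r T) U :=
  DepOn.div ((hq.sumOver _).mono sdiff_subset) ((hq.sumOver _).mono sdiff_subset)

lemma fixK_nonneg (K : PreCADMG Vt) (r : Vt) {q : (∀ v, 𝔛 v) → ℝ} (hq : ∀ x, 0 ≤ q x)
    (x : ∀ v, 𝔛 v) : 0 ≤ fixK K r q x :=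
  div_nonneg (hq x) (div_nonneg (sumOver_nonneg hq _ x) (sumOver_nonneg hq _ x))

lemma fixK_pos_iff (K : PreCADMG Vt) (r : Vt) {q : (∀ v, 𝔛 v) → ℝ} (hq : ∀ x, 0 ≤ q x)
    (x : ∀ v, 𝔛 v) : 0 < fixK K r q x ↔ 0 < q x := by
  constructor
  · intro h
    refine (hq x).lt_of_ne fun h0 => ?_
    simp [fixK, ← h0] at h
  · intro h
    exact div_pos h (condOn_pos hq h _ _)

end Sums

section Graphs

variable {Vt : Type} [Fintype Vt] [DecidableEq Vt] {K : PreCADMG Vt} {ord : Vt → ℕ}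

lemma PreCADMG.WF.fixG (h : K.WF) (r : Vt) : (Nested.fixG K r).WF := by
  obtain ⟨h1, h2, h3, h4, h5⟩ := h
  refine ⟨?_, fun a b hab => ⟨h2 a b hab.1, hab.2.2, hab.2.1⟩, ?_, ?_, ?_⟩
  · simp only [Nested.fixG, Finset.disjoint_left, mem_erase, mem_insert]
    rintro a ⟨har, ha⟩ (h | h)
    · exact har h
    · exact Finset.disjoint_left.mp h1 ha h
  · rintro a b ⟨hab, hb⟩
    obtain ⟨ha, hb'⟩ := h3 a b hab
    refine ⟨?_, mem_erase.mpr ⟨hb, hb'⟩⟩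
    simp only [Nested.fixG, mem_union, mem_erase, mem_insert] at ha ⊢
    tauto
  · rintro a b ⟨hab, ha, hb⟩
    exact ⟨mem_erase.mpr ⟨ha, (h4 a b hab).1⟩, mem_erase.mpr ⟨hb, (h4 a b hab).2⟩⟩
  · exact fun v hv => h5 v (Relation.TransGen.mono (fun _ _ hab => hab.1) _ _ hv)

lemma IsTopo.fixG (h : IsTopo K ord) (r : Vt) : IsTopo (Nested.fixG K r) ord :=
  ⟨h.1, fun a b hab hba => h.2 a b hab (Relation.ReflTransGen.mono (fun _ _ hcd => hcd.1) _ _ hba)⟩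

lemma PreCADMG.WF.fixGs {us : List Vt} : ∀ {K : PreCADMG Vt}, K.WF → (Nested.fixGs K us).WF := by
  induction us with
  | nil => exact fun h => h
  | cons r us ih => exact fun h => ih (h.fixG r)

lemma IsTopo.fixGs {us : List Vt} :
    ∀ {K : PreCADMG Vt}, IsTopo K ord → IsTopo (Nested.fixGs K us) ord := by
  induction us with
  | nil => exact fun h => h
  | cons r us ih => exact fun h => ih (h.fixG r)

lemma fixGs_V (us : List Vt) : ∀ K : PreCADMG Vt, (fixGs K us).V = K.V \ us.toFinset := by
  induction us with
  | nil => intro K; simp [fixGs]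
  | cons r us ih =>
    intro K
    rw [fixGs, ih]
    ext v
    simp [fixG]
    tauto

lemma fixGs_dir (us : List Vt) :
    ∀ (K : PreCADMG Vt) (a b : Vt), (fixGs K us).dir a b ↔ K.dir a b ∧ b ∉ us := by
  induction us with
  | nil => intro K a b; simp [fixGs]
  | cons r us ih =>
    intro K a b
    rw [fixGs, ih]
    simp [fixG, and_assoc]

lemma fixGs_bi (us : List Vt) :
    ∀ (K : PreCADMG Vt) (a b : Vt), (fixGs K us).bi a b ↔ K.bi a b ∧ a ∉ us ∧ b ∉ us := by
  induction us with
  | nil => intro K a b; simp [fixGs]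
  | cons r us ih =>
    intro K a b
    rw [fixGs, ih]
    simp [fixG]
    tauto

lemma ValidSeq.subset {us : List Vt} : ∀ {K : PreCADMG Vt}, ValidSeq K us → us.toFinset ⊆ K.V := by
  induction us with
  | nil => simp
  | cons r us ih =>
    rintro K ⟨hr, hus⟩
    intro v hv
    rcases List.mem_cons.mp (List.mem_toFinset.mp hv) with rfl | hv
    · exact hr.1
    · exact mem_of_mem_erase (ih hus (List.mem_toFinset.mpr hv))

lemma ValidSeq.nodup {us : List Vt} : ∀ {K : PreCADMG Vt}, ValidSeq K us → us.Nodup := by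
  induction us with
  | nil => simp
  | cons r us ih =>
    rintro K ⟨hr, hus⟩
    refine List.nodup_cons.mpr ⟨fun hmem => ?_, ih hus⟩
    exact (mem_erase.mp (hus.subset (List.mem_toFinset.mpr hmem))).1 rfl

lemma mem_dis_self {v : Vt} (hv : v ∈ K.V) : v ∈ dis K v :=
  mem_filter.mpr ⟨hv, .refl⟩

lemma dis_subset (v : Vt) : dis K v ⊆ K.V := filter_subset _ _

lemma dis_eq_of_mem (h : K.WF) {v w : Vt} (hw : w ∈ dis K v) : dis K w = dis K v := by
  have hvw := (mem_filter.mp hw).2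
  have hwv : Relation.ReflTransGen K.bi w v := by
    clear hw
    induction hvw with
    | refl => exact .refl
    | tail _ hbc ih => exact .head (h.2.1 _ _ hbc) ih
  ext u
  simp only [dis, mem_filter]
  exact ⟨fun hu => ⟨hu.1, hvw.trans hu.2⟩, fun hu => ⟨hu.1, hwv.trans hu.2⟩⟩

lemma mem_dis_comm (h : K.WF) {v w : Vt} (hv : v ∈ K.V) (hw : w ∈ dis K v) : v ∈ dis K w := by
  rw [dis_eq_of_mem h hw]
  exact mem_dis_self hv

lemma insert_mb {v : Vt} (hv : v ∈ K.V) :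
    insert v (mb K v) = dis K v ∪ paS K (dis K v) := by
  ext u
  have := mem_dis_self hv
  simp only [mb, mem_insert, mem_union, mem_erase]
  by_cases huv : u = v
  · subst huv; simp [this]
  · simp [huv]; tauto

lemma insert_mb_subset {v : Vt} (hv : v ∈ K.V) : insert v (mb K v) ⊆ K.V ∪ K.W := by
  rw [insert_mb hv]
  exact union_subset ((dis_subset v).trans subset_union_left) (filter_subset _ _)

lemma dis_fixG_subset (r v : Vt) : dis (fixG K r) v ⊆ dis K v := by
  intro w hw
  obtain ⟨h1, h2⟩ := mem_filter.mp hw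
  exact mem_filter.mpr ⟨mem_of_mem_erase h1,
    Relation.ReflTransGen.mono (fun _ _ hab => hab.1) _ _ h2⟩

lemma fixG_V_union_W {r : Vt} (hr : r ∈ K.V) : (fixG K r).V ∪ (fixG K r).W = K.V ∪ K.W := by
  ext v
  simp only [fixG, mem_union, mem_erase, mem_insert]
  by_cases h : v = r
  · subst h; simp [hr]
  · simp [h]

lemma fixGs_V_union_W {us : List Vt} :
    ∀ {K : PreCADMG Vt}, ValidSeq K us → (fixGs K us).V ∪ (fixGs K us).W = K.V ∪ K.W := by
  induction us with
  | nil => exact fun _ => rfl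
  | cons r us ih => exact fun h => (ih h.2).trans (fixG_V_union_W h.1.1)

lemma insert_mb_fixG_subset {r v : Vt} (hr : r ∈ K.V) (hv : v ∈ (fixG K r).V) :
    insert v (mb (fixG K r) v) ⊆ insert v (mb K v) := by
  rw [insert_mb hv, insert_mb (mem_of_mem_erase hv)]
  refine union_subset_union (dis_fixG_subset r v) fun u hu => ?_
  simp only [paS, mem_filter, fixG_V_union_W hr] at hu ⊢
  obtain ⟨hu, d, hd, hud⟩ := hu
  exact ⟨hu, d, dis_fixG_subset r v hd, hud.1⟩

lemma dis_fixG (h : K.WF) {r m : Vt} (hr : r ∉ dis K m) :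
    dis (fixG K r) m = dis K m := by
  refine (dis_fixG_subset r m).antisymm fun w hw => ?_
  obtain ⟨hwV, hmw⟩ := mem_filter.mp hw
  refine mem_filter.mpr ⟨mem_erase.mpr ⟨fun hwr => hr (hwr ▸ hw), hwV⟩, ?_⟩
  clear hw hwV
  induction hmw with
  | refl => exact .refl
  | @tail b c hab hbc ih =>
    obtain ⟨hb, hc⟩ := h.2.2.2.1 _ _ hbc
    refine ih.tail ⟨hbc, ?_, ?_⟩
    · rintro rfl
      exact hr (mem_filter.mpr ⟨hb, hab⟩)
    · rintro rfl
      exact hr (mem_filter.mpr ⟨hc, hab.tail hbc⟩)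

lemma mb_fixG (h : K.WF) {r m : Vt} (hrV : r ∈ K.V) (hr : r ∉ dis K m) :
    mb (fixG K r) m = mb K m := by
  unfold mb
  rw [dis_fixG h hr]
  congr 1
  ext u
  simp only [paS, mem_filter, fixG_V_union_W hrV]
  refine and_congr_right fun _ => exists_congr fun d => and_congr_right fun hd => ?_
  exact ⟨fun hud => hud.1, fun hud => ⟨hud, fun hdr => hr (hdr ▸ hd)⟩⟩

lemma not_mem_mb_of_childless {m : Vt} (hm : ∀ b, ¬ K.dir m b) : m ∉ mb K m := by
  simp only [mb, paS, mem_union, mem_filter, mem_erase]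
  rintro (⟨_, d, _, hd⟩ | ⟨h, _⟩)
  · exact hm d hd
  · exact h rfl

lemma fixable_of_childless {m : Vt} (hmV : m ∈ K.V) (hm : ∀ b, ¬ K.dir m b) : fixable K m := by
  refine ⟨hmV, ?_⟩
  ext w
  simp only [deF, mem_inter, mem_filter, mem_singleton]
  constructor
  · rintro ⟨_, _, hw⟩
    rcases hw.cases_head with h | ⟨c, hc, _⟩
    · exact h.symm
    · exact absurd hc (hm c)
  · rintro rfl
    exact ⟨mem_dis_self hmV, mem_union_left _ hmV, .refl⟩

lemma IsTopo.le_of_reach (ht : IsTopo K ord) {a b : Vt}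
    (hab : Relation.ReflTransGen K.dir a b) : ord a ≤ ord b :=
  not_lt.mp fun hlt => ht.2 b a hlt hab

lemma IsTopo.lt_of_dir (h : K.WF) (ht : IsTopo K ord) {a b : Vt} (hab : K.dir a b) :
    ord a < ord b := by
  refine (ht.le_of_reach (.single hab)).lt_of_ne fun he => ?_
  cases ht.1 he
  exact h.2.2.2.2 a (.single hab)

lemma childless_of_max (h : K.WF) (ht : IsTopo K ord) {m : Vt}
    (hmax : ∀ c ∈ K.V, ord c ≤ ord m) (b : Vt) : ¬ K.dir m b :=
  fun hmb => (hmax b (h.2.2.1 m b hmb).2).not_gt (ht.lt_of_dir h hmb)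

lemma fixable_of_max_sdiff (h : K.WF) (ht : IsTopo K ord) {m r : Vt} (hr : r ∈ K.V \ dis K m)
    (hmax : ∀ c ∈ K.V \ dis K m, ord c ≤ ord r) : fixable K r := by
  obtain ⟨hrV, hrD⟩ := mem_sdiff.mp hr
  refine ⟨hrV, ?_⟩
  ext w
  simp only [mem_inter, mem_singleton]
  constructor
  · rintro ⟨hw, hw'⟩
    have hwD : w ∉ dis K m := by
      intro hwm
      have := dis_eq_of_mem h hw
      rw [dis_eq_of_mem h hwm] at this
      exact hrD (this ▸ mem_dis_self hrV)
    have h1 := hmax w (mem_sdiff.mpr ⟨dis_subset _ hw, hwD⟩)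
    have h2 := ht.le_of_reach (mem_filter.mp hw').2
    exact ht.1 (h1.antisymm h2)
  · rintro rfl
    exact ⟨mem_dis_self hrV, mem_filter.mpr ⟨mem_union_left _ hrV, .refl⟩⟩

lemma not_mem_mb_of_fixable (h : K.WF) {r : Vt} (hr : fixable K r) : r ∉ mb K r := by
  simp only [mb, paS, mem_union, mem_filter, mem_erase]
  rintro (⟨_, d, hd, hrd⟩ | ⟨h', _⟩)
  · have hdr : d ∈ dis K r ∩ deF K r :=
      mem_inter.mpr ⟨hd, mem_filter.mpr ⟨mem_union_left _ (dis_subset _ hd), .single hrd⟩⟩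
    rw [hr.2, mem_singleton] at hdr
    subst hdr
    exact h.2.2.2.2 _ (.single hrd)
  · exact h' rfl

end Graphs

section Kernels

variable {Vt : Type} [Fintype Vt] [DecidableEq Vt] {𝔛 : Vt → Type} [∀ v, Fintype (𝔛 v)]
  {K : PreCADMG Vt} {ord : Vt → ℕ} {q : (∀ v, 𝔛 v) → ℝ}

/-- The conditional kernel of `x_m` given all other coordinates is, wherever defined, a function
of `x_m` and `x_T` only. -/
def CondLocal (q : (∀ v, 𝔛 v) → ℝ) (m : Vt) (T : Finset Vt) : Prop :=
  ∀ x y : ∀ v, 𝔛 v, (∀ v ∈ insert m T, x v = y v) → 0 < sumOver {m} q x → 0 < sumOver {m} q y →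
    q x / sumOver {m} q x = q y / sumOver {m} q y

/-- Every kernel reachable from `q` whose graph has a single district satisfies the local
property at its greatest random vertex. -/
def HerLocal (K : PreCADMG Vt) (ord : Vt → ℕ) (q : (∀ v, 𝔛 v) → ℝ) : Prop :=
  ∀ us, ValidSeq K us → ∀ m ∈ (fixGs K us).V, (∀ c ∈ (fixGs K us).V, ord c ≤ ord m) →
    dis (fixGs K us) m = (fixGs K us).V → CondLocal (fixKs K q us) m (mb (fixGs K us) m)

lemma HerLocal.fixK (h : HerLocal K ord q) {r : Vt} (hr : fixable K r) :
    HerLocal (fixG K r) ord (Nested.fixK K r q) :=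
  fun us hus => h (r :: us) ⟨hr, hus⟩

lemma HerLocal.fixKs {us : List Vt} : ∀ {K : PreCADMG Vt} {q : (∀ v, 𝔛 v) → ℝ},
    HerLocal K ord q → ValidSeq K us → HerLocal (fixGs K us) ord (Nested.fixKs K q us) := by
  induction us with
  | nil => exact fun h _ => h
  | cons r us ih => exact fun h hus => ih (h.fixK hus.1) hus.2

lemma DepOn.fixK (hq : DepOn q (K.V ∪ K.W)) {r : Vt} (hr : r ∈ K.V) :
    DepOn (Nested.fixK K r q) ((fixG K r).V ∪ (fixG K r).W) := by
  rw [fixG_V_union_W hr]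
  exact hq.div (hq.condOn _ _)

lemma DepOn.fixKs {us : List Vt} : ∀ {K : PreCADMG Vt} {q : (∀ v, 𝔛 v) → ℝ},
    DepOn q (K.V ∪ K.W) → ValidSeq K us →
      DepOn (Nested.fixKs K q us) ((fixGs K us).V ∪ (fixGs K us).W) := by
  induction us with
  | nil => exact fun h _ => h
  | cons r us ih => exact fun h hus => ih (h.fixK hus.1.1) hus.2

/-- Fixing a vertex whose Markov blanket avoids `m` does not change the conditional kernel of
`x_m` given everything else. -/
lemma CondLocal.of_fixK (hq : ∀ x, 0 ≤ q x) {r m : Vt} (hm : m ∈ K.V)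
    (hmr : m ∉ insert r (mb K r)) {T : Finset Vt} (h : CondLocal (fixK K r q) m T) :
    CondLocal q m T := by
  have hdep : DepOn (condOn K.V q r (mb K r)) (univ \ {m}) :=
    (depOn_condOn _ _ _ _).mono (sdiff_subset_sdiff subset_rfl
      (singleton_subset_iff.mpr (mem_sdiff.mpr ⟨hm, hmr⟩)))
  have hsum : ∀ x, sumOver {m} (fixK K r q) x
      = sumOver {m} q x / condOn K.V q r (mb K r) x :=
    sumOver_div hdep sdiff_disjoint q
  have hpos : ∀ x, 0 < sumOver {m} q x → 0 < condOn K.V q r (mb K r) x := by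
    intro x hx
    obtain ⟨z, hz, hqz⟩ := exists_pos_of_sumOver_pos hx
    rw [← hdep z x fun v hv => hz v (mem_sdiff.mp hv).2]
    exact condOn_pos hq hqz _ _
  intro x y hxy hx hy
  have hkx := hpos x hx
  have hky := hpos y hy
  have := h x y hxy (by rw [hsum]; exact div_pos hx hkx) (by rw [hsum]; exact div_pos hy hky)
  rwa [hsum, hsum, fixK, fixK, div_div_div_cancel_right₀ hkx.ne',
    div_div_div_cancel_right₀ hky.ne'] at this

lemma condLocal_of_max {n : ℕ} : ∀ {K : PreCADMG Vt} {q : (∀ v, 𝔛 v) → ℝ}, K.WF →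
    IsTopo K ord → (∀ x, 0 ≤ q x) → HerLocal K ord q → ∀ m ∈ K.V,
    (∀ c ∈ K.V, ord c ≤ ord m) → (K.V \ dis K m).card = n → CondLocal q m (mb K m) := by
  induction n with
  | zero =>
    intro K q _ _ _ hloc m hm hmax hcard
    refine hloc [] trivial m hm hmax ((dis_subset m).antisymm ?_)
    exact sdiff_eq_empty_iff_subset.mp (card_eq_zero.mp hcard)
  | succ n ih =>
    intro K q hWF ht hq hloc m hm hmax hcard
    obtain ⟨r, hr, hrmax⟩ := exists_max_image (K.V \ dis K m) ord
      (card_pos.mp (by omega))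
    obtain ⟨hrV, hrD⟩ := mem_sdiff.mp hr
    have hfix := fixable_of_max_sdiff hWF ht hr hrmax
    have hmr : m ≠ r := fun h => hrD (h ▸ mem_dis_self hm)
    have hch := childless_of_max hWF ht hmax
    have key := ih (hWF.fixG r) (ht.fixG r) (fixK_nonneg K r hq) (hloc.fixK hfix) m
      (mem_erase.mpr ⟨hmr, hm⟩) (fun c hc => hmax c (mem_of_mem_erase hc)) (by
        rw [dis_fixG hWF hrD]
        have : (fixG K r).V \ dis K m = (K.V \ dis K m).erase r := by
          ext v
          simp [fixG, and_assoc]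
        rw [this, card_erase_of_mem hr, hcard]
        rfl)
    rw [mb_fixG hWF hrV hrD] at key
    refine key.of_fixK hq hm ?_
    rw [insert_mb hrV, mem_union, not_or]
    refine ⟨fun h => ?_, fun h => ?_⟩
    · exact hrD (mem_dis_comm hWF hrV h)
    · obtain ⟨_, d, _, hd⟩ := mem_filter.mp h
      exact hch d hd

lemma ord_lt_of_mem_mb (hWF : K.WF) (ht : IsTopo K ord) {m : Vt}
    (hmax : ∀ c ∈ K.V, ord c ≤ ord m) {v : Vt} (hv : v ∈ mb K m) : ord v < ord m := by
  rcases mem_union.mp hv with h | h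
  · obtain ⟨_, d, hd, hvd⟩ := mem_filter.mp h
    exact (ht.lt_of_dir hWF hvd).trans_le (hmax d (dis_subset _ hd))
  · obtain ⟨hne, h⟩ := mem_erase.mp h
    exact (hmax v (dis_subset _ h)).lt_of_ne fun he => hne (ht.1 he)

lemma pos_update {n : ℕ} : ∀ {K : PreCADMG Vt} {q : (∀ v, 𝔛 v) → ℝ}, K.WF →
    IsTopo K ord → (∀ x, 0 ≤ q x) → HerLocal K ord q → K.V.card = n → ∀ t ∈ K.V,
    ∀ x y : ∀ v, 𝔛 v, (∀ v, ord v < ord t → x v = y v) → 0 < q x → 0 < q y →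
      0 < q (Function.update y t (x t)) := by
  induction n with
  | zero =>
    intro K q _ _ _ _ hcard t ht
    simp [card_eq_zero.mp hcard] at ht
  | succ n ih =>
    intro K q hWF htopo hq hloc hcard t ht x y hxy hx hy
    obtain ⟨m, hm, hmax⟩ := exists_max_image K.V ord ⟨t, ht⟩
    by_cases htm : t = m
    · subst htm
      have hsum : sumOver {t} q (Function.update y t (x t)) = sumOver {t} q y :=
        (depOn_sumOver q {t}).update_eq (by simp) y (x t)
      have hsx := hx.trans_le (le_sumOver hq {t} x)
      have hsy := hy.trans_le (le_sumOver hq {t} y)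
      have key := condLocal_of_max hWF htopo hq hloc t hm hmax rfl x
        (Function.update y t (x t)) (fun v hv => by
          rcases mem_insert.mp hv with rfl | hv
          · simp
          · have hlt := ord_lt_of_mem_mb hWF htopo hmax hv
            rw [Function.update_of_ne (fun h => by simp [h] at hlt), hxy v hlt])
        hsx (hsum ▸ hsy)
      have h1 := div_pos hx hsx
      rw [key, hsum] at h1
      exact (div_pos_iff_of_pos_right hsy).mp h1
    · have hfix := fixable_of_childless hm (childless_of_max hWF htopo hmax)
      have := ih (hWF.fixG m) (htopo.fixG m) (fixK_nonneg K m hq) (hloc.fixK hfix)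
        (by simp [fixG, card_erase_of_mem hm, hcard]) t (mem_erase.mpr ⟨htm, ht⟩) x y hxy
      simp only [fixK_pos_iff K m hq] at this
      exact this hx hy

lemma pos_piecewise {p : (∀ v, 𝔛 v) → ℝ} {T : Finset Vt}
    (hT : ∀ t ∈ T, ∀ x y : ∀ v, 𝔛 v, 0 < p x → 0 < p y → 0 < p (Function.update y t (x t)))
    {x y : ∀ v, 𝔛 v} (hx : 0 < p x) (hy : 0 < p y) : 0 < p (T.piecewise x y) := by
  induction T using Finset.induction_on with
  | empty => simpa using hy
  | insert a T _ ih =>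
    rw [piecewise_insert]
    exact hT a (mem_insert_self _ _) _ _ hx (ih fun t ht => hT t (mem_insert_of_mem ht))

lemma pos_update_of_pos (hWF : K.WF) (htopo : IsTopo K ord) (hW : K.W = ∅)
    (hq : ∀ x, 0 ≤ q x) (hdep : DepOn q (K.V ∪ K.W)) (hloc : HerLocal K ord q) :
    ∀ (n : ℕ) (t : Vt), ord t = n → ∀ x y : ∀ v, 𝔛 v, 0 < q x → 0 < q y →
      0 < q (Function.update y t (x t)) := by
  intro n
  induction n using Nat.strong_induction_on with
  | _ n ih =>
    intro t htn x y hx hy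
    by_cases ht : t ∈ K.V
    · set T := univ.filter fun v => ord v < ord t with hTdef
      have hT : ∀ s ∈ T, ∀ x y : ∀ v, 𝔛 v, 0 < q x → 0 < q y →
          0 < q (Function.update y s (x s)) := fun s hs =>
        ih (ord s) (htn ▸ (mem_filter.mp hs).2) s rfl
      have h1 := pos_update hWF htopo hq hloc rfl t ht x (T.piecewise x y)
        (fun v hv => by simp [hTdef, hv]) hx (pos_piecewise hT hx hy)
      have h2 := pos_piecewise hT hy h1
      convert h2 using 2
      funext v
      by_cases hvt : v = t
      · subst hvt; simp [hTdef]
      · by_cases hvT : v ∈ T <;> simp [hvT, hvt]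
    · rw [hdep.update_eq (by simpa [hW] using ht)]
      exact hy

/-- The support of a distribution obeying the hereditary local property is a product set. -/
lemma pos_of_forall_coord (hWF : K.WF) (htopo : IsTopo K ord) (hW : K.W = ∅)
    (hq : ∀ x, 0 ≤ q x) (hdep : DepOn q (K.V ∪ K.W)) (hloc : HerLocal K ord q)
    {x₀ : ∀ v, 𝔛 v} (hx₀ : 0 < q x₀) (z : ∀ v, 𝔛 v) (hz : ∀ v, ∃ x, 0 < q x ∧ x v = z v) :
    0 < q z := by
  have key : ∀ T : Finset Vt, ∃ w, 0 < q w ∧ ∀ v ∈ T, w v = z v := by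
    intro T
    induction T using Finset.induction_on with
    | empty => exact ⟨x₀, hx₀, by simp⟩
    | insert a T _ ih =>
      obtain ⟨w, hw, hwT⟩ := ih
      obtain ⟨x, hx, hxa⟩ := hz a
      refine ⟨_, pos_update_of_pos hWF htopo hW hq hdep hloc _ a rfl x w hx hw, ?_⟩
      intro v hv
      by_cases hva : v = a
      · subst hva; simpa using hxa
      · simpa [hva] using hwT v (mem_of_mem_insert_of_ne hv hva)
  obtain ⟨w, hw, hwz⟩ := key univ
  rwa [← funext fun v => hwz v (mem_univ v)]

lemma herLocal_of_nestedLocal (hWF : K.WF) (htopo : IsTopo K ord)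
    (hdep : DepOn q (K.V ∪ K.W)) (h : NestedLocal K ord q) : HerLocal K ord q := by
  intro us hus m hm hmax hdis
  have hV := fixGs_V us K
  have hL := h (fixGs K us).V ⟨us, hus.nodup, hus, mem_image.mpr ⟨m, hm, hdis⟩⟩ us hus.nodup hus
    (by rw [hV, Finset.sdiff_sdiff_eq_self hus.subset]) m hm hmax
  have hdep' := hdep.fixKs hus
  have hmm := not_mem_mb_of_childless (childless_of_max hWF.fixGs htopo.fixGs hmax)
  set J := fixGs K us
  set f := fixKs K q us
  have hVW := insert_mb_subset hm
  have e2 : J.V \ ({m} ∪ ((J.V ∪ J.W) \ insert m (mb J m)) ∪ mb J m) = ∅ := by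
    ext v
    simp
    tauto
  rcases hL with ⟨-, hL⟩ | ⟨hB, -⟩
  · have e1 : J.V \ (((J.V ∪ J.W) \ insert m (mb J m)) ∪ mb J m) = {m} := by
      ext v
      by_cases hv : v = m
      · subst hv; simp [hm, hmm]
      · simp [hv]; tauto
    intro x y hxy hx hy
    have := hL x y (by simpa using hxy)
    rw [e1, e2] at this
    simpa using this hx hy
  · intro x y hxy _ _
    have hag : ∀ v ∈ J.V ∪ J.W, x v = y v := by
      intro v hv
      by_contra hne
      have hvn : v ∉ insert m (mb J m) := fun h => hne (hxy v h)
      have hvV : v ∉ J.V := fun h => hvn (by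
        rw [insert_mb hm, hdis]
        exact mem_union_left _ h)
      have hvW : v ∈ J.W := (mem_union.mp hv).resolve_left hvV
      have : v ∈ ((J.V ∪ J.W) \ insert m (mb J m)) ∩ J.W :=
        mem_inter.mpr ⟨mem_sdiff.mpr ⟨hv, hvn⟩, hvW⟩
      rw [hB] at this
      simp at this
    rw [hdep' x y hag, (hdep'.sumOver {m}) x y fun v hv => hag v (mem_sdiff.mp hv).1]

end Kernels

section PositiveKernels

variable {Vt : Type} [Fintype Vt] [DecidableEq Vt] {𝔛 : Vt → Type} [∀ v, Fintype (𝔛 v)]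
  {K : PreCADMG Vt} {ord : Vt → ℕ} {q : (∀ v, 𝔛 v) → ℝ}

/-- A strictly positive kernel for the random and fixed vertices of `K`. -/
def PosKernel (K : PreCADMG Vt) (q : (∀ v, 𝔛 v) → ℝ) : Prop :=
  (∀ x, 0 < q x) ∧ DepOn q (K.V ∪ K.W) ∧ ∀ x, sumOver K.V q x = 1

/-- `q` is a product over the random vertices of functions of district closures. -/
def VertexFactor (K : PreCADMG Vt) (q : (∀ v, 𝔛 v) → ℝ) : Prop :=
  ∃ f : Vt → (∀ v, 𝔛 v) → ℝ, (∀ v ∈ K.V, DepOn (f v) (insert v (mb K v))) ∧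
    ∀ x, q x = ∏ v ∈ K.V, f v x

lemma sumOver_pos (hq : ∀ x, 0 < q x) (S : Finset Vt) (x : ∀ v, 𝔛 v) : 0 < sumOver S q x :=
  (hq x).trans_le (le_sumOver (fun y => (hq y).le) S x)

lemma PosKernel.fixK (hWF : K.WF) (h : PosKernel K q) {r : Vt} (hr : fixable K r) :
    PosKernel (fixG K r) (Nested.fixK K r q) := by
  obtain ⟨hpos, hdep, hsum⟩ := h
  have hle := fun y => (hpos y).le
  refine ⟨fun x => (fixK_pos_iff K r hle x).mpr (hpos x), hdep.fixK hr.1, fun x => ?_⟩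
  have hmb := not_mem_mb_of_fixable hWF hr
  set M := mb K r
  have hV : (fixG K r).V = (K.V ∩ M) ∪ (K.V \ insert r M) := by
    ext v
    by_cases hv : v = r
    · subst hv; simp [fixG, hmb]
    · by_cases hvM : v ∈ M <;> simp [fixG, hv, hvM]
  have hdisj : Disjoint (K.V ∩ M) (K.V \ insert r M) := by
    rw [Finset.disjoint_left]
    intro v hv hv'
    simp at hv hv'
    exact hv'.2.2 hv.2
  have hinner : sumOver (K.V \ insert r M) (Nested.fixK K r q) = sumOver (K.V \ M) q := by
    funext y
    have h1 : sumOver (K.V \ insert r M) (Nested.fixK K r q) y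
        = sumOver (K.V \ insert r M) q y / condOn K.V q r M y :=
      sumOver_div (depOn_condOn _ _ _ _) sdiff_disjoint q y
    have h2 := (sumOver_pos hpos (K.V \ insert r M) y).ne'
    rw [h1, condOn, div_div_cancel₀ h2]
  rw [hV, sumOver_union hdisj, hinner, ← hsum x, ← sumOver_sdiff (S := K.V \ M) sdiff_subset q]
  congr 1
  ext v
  simp

lemma PosKernel.fixKs {us : List Vt} : ∀ {K : PreCADMG Vt} {q : (∀ v, 𝔛 v) → ℝ}, K.WF →
    PosKernel K q → ValidSeq K us → PosKernel (fixGs K us) (Nested.fixKs K q us) := by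
  induction us with
  | nil => exact fun _ h _ => h
  | cons r us ih => exact fun hWF h hus => ih (hWF.fixG r) (h.fixK hWF hus.1) hus.2

/-- The ratio `q / ∑_m q` is a function of `x_m` and `x_T` only. -/
lemma CondLocal.depOn (hq : ∀ x, 0 < q x) {m : Vt} {T : Finset Vt} (h : CondLocal q m T) :
    DepOn (fun x => q x / sumOver {m} q x) (insert m T) :=
  fun x y hxy => h x y hxy (sumOver_pos hq _ x) (sumOver_pos hq _ y)

lemma fixK_eq_sumOver (hq : ∀ x, 0 < q x) {m : Vt} (hm : m ∈ K.V) (hmm : m ∉ mb K m)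
    (h : CondLocal q m (mb K m)) : fixK K m q = sumOver {m} q := by
  set k := fun x => q x / sumOver {m} q x with hk
  have hkd : DepOn k (insert m (mb K m)) := h.depOn hq
  have hqk : q = fun x => k x * sumOver {m} q x :=
    funext fun x => (div_mul_cancel₀ _ (sumOver_pos hq {m} x).ne').symm
  have hV : K.V \ mb K m = (K.V \ insert m (mb K m)) ∪ {m} := by
    ext v
    by_cases hv : v = m
    · subst hv; simp [hm, hmm]
    · simp [hv]
  have hdisj : Disjoint (K.V \ insert m (mb K m)) {m} := by simp
  funext x
  have hnum : sumOver (K.V \ insert m (mb K m)) q x = k x * sumOver (K.V \ mb K m) q x := by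
    rw [hV, sumOver_union hdisj]
    conv_lhs => rw [hqk]
    exact sumOver_mul_left hkd disjoint_sdiff _ x
  have hcond : condOn K.V q m (mb K m) x = k x := by
    rw [condOn, hnum, mul_div_cancel_right₀ _ (sumOver_pos hq _ x).ne']
  rw [fixK, hcond, hk, div_div_cancel₀ (hq x).ne']

lemma vertexFactor_of {n : ℕ} : ∀ {K : PreCADMG Vt} {q : (∀ v, 𝔛 v) → ℝ}, K.WF →
    IsTopo K ord → PosKernel K q → HerLocal K ord q → K.V.card = n → VertexFactor K q := by
  induction n with
  | zero =>
    intro K q _ _ hq _ hcard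
    have hV := card_eq_zero.mp hcard
    refine ⟨fun _ _ => 1, fun _ _ _ _ _ => rfl, fun x => ?_⟩
    have := hq.2.2 x
    rw [hV, sumOver_empty] at this
    simp [this]
  | succ n ih =>
    intro K q hWF ht hq hloc hcard
    obtain ⟨m, hm, hmax⟩ := exists_max_image K.V ord (card_pos.mp (by omega))
    have hch := childless_of_max hWF ht hmax
    have hfix := fixable_of_childless hm hch
    have hcl := condLocal_of_max hWF ht (fun x => (hq.1 x).le) hloc m hm hmax rfl
    obtain ⟨f, hf, hqf⟩ := ih (hWF.fixG m) (ht.fixG m) (hq.fixK hWF hfix) (hloc.fixK hfix)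
      (by simp [fixG, card_erase_of_mem hm, hcard])
    rw [fixK_eq_sumOver hq.1 hm (not_mem_mb_of_childless hch) hcl] at hqf
    refine ⟨Function.update f m fun x => q x / sumOver {m} q x, fun v hv => ?_, fun x => ?_⟩
    · by_cases hvm : v = m
      · subst hvm
        rw [Function.update_self]
        exact hcl.depOn hq.1
      · rw [Function.update_of_ne hvm]
        have hv' : v ∈ (fixG K m).V := mem_erase.mpr ⟨hvm, hv⟩
        exact (hf v hv').mono (insert_mb_fixG_subset hm hv')
    · rw [← mul_prod_erase _ _ hm, Function.update_self,
        prod_congr rfl fun v hv => by rw [Function.update_of_ne (ne_of_mem_erase hv)]]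
      change q x = _ * ∏ v ∈ (fixG K m).V, f v x
      rw [← hqf, div_mul_cancel₀ _ (sumOver_pos hq.1 _ x).ne']

lemma insert_mb_eq_of_mem_dis (hWF : K.WF) {t v : Vt} (ht : t ∈ K.V) (hv : v ∈ dis K t) :
    insert v (mb K v) = insert t (mb K t) := by
  rw [insert_mb ht, insert_mb (dis_subset _ hv), dis_eq_of_mem hWF hv]

lemma condLocal_of_factor (hWF : K.WF) (hq : ∀ x, 0 < q x) (hfac : VertexFactor K q) {t : Vt}
    (ht : t ∈ K.V) (hch : ∀ b, ¬ K.dir t b) : CondLocal q t (mb K t) := by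
  obtain ⟨f, hf, hqf⟩ := hfac
  set g : (∀ v, 𝔛 v) → ℝ := fun x => ∏ v ∈ dis K t, f v x
  set k : (∀ v, 𝔛 v) → ℝ := fun x => ∏ v ∈ K.V \ dis K t, f v x
  have hg : DepOn g (insert t (mb K t)) := DepOn.prod fun v hv =>
    insert_mb_eq_of_mem_dis hWF ht hv ▸ hf v (dis_subset _ hv)
  have hk : DepOn k (univ \ {t}) := DepOn.prod fun v hv => by
    obtain ⟨hvV, hvD⟩ := mem_sdiff.mp hv
    refine (hf v hvV).mono fun u hu => mem_sdiff.mpr ⟨mem_univ _, fun hut => ?_⟩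
    rw [mem_singleton.mp hut, insert_mb hvV, mem_union] at hu
    rcases hu with hu | hu
    · exact hvD (mem_dis_comm hWF hvV hu)
    · obtain ⟨_, d, _, hd⟩ := mem_filter.mp hu
      exact hch d hd
  have hqgk : ∀ x, q x = k x * g x := fun x => by
    rw [hqf, prod_sdiff (dis_subset t)]
  have hsum : ∀ x, sumOver {t} q x = k x * sumOver {t} g x := fun x => by
    rw [funext hqgk]
    exact sumOver_mul_left hk sdiff_disjoint g x
  have hk0 : ∀ x, k x ≠ 0 := fun x h0 => (hq x).ne' (by rw [hqgk, h0, zero_mul])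
  intro x y hxy _ _
  rw [hsum, hsum, hqgk, hqgk, mul_div_mul_left _ _ (hk0 x), mul_div_mul_left _ _ (hk0 y),
    hg x y hxy, (hg.sumOver {t}).mono sdiff_subset x y hxy]

/-- Summing out a set of random vertices closed under children amounts to fixing it. -/
lemma exists_fixKs_eq_sumOver {n : ℕ} : ∀ {K : PreCADMG Vt} {q : (∀ v, 𝔛 v) → ℝ}, K.WF →
    IsTopo K ord → PosKernel K q → HerLocal K ord q → ∀ T ⊆ K.V,
    (∀ a ∈ T, ∀ b, K.dir a b → b ∈ T) → T.card = n →
    ∃ us, ValidSeq K us ∧ us.toFinset = T ∧ fixKs K q us = sumOver T q := by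
  induction n with
  | zero =>
    intro K q _ _ _ _ T _ _ hcard
    refine ⟨[], trivial, (card_eq_zero.mp hcard).symm, ?_⟩
    rw [card_eq_zero.mp hcard, sumOver_empty]
    rfl
  | succ n ih =>
    intro K q hWF ht hq hloc T hTV hT hcard
    obtain ⟨t, htT, hmax⟩ := exists_max_image T ord (card_pos.mp (by omega))
    have hch : ∀ b, ¬ K.dir t b := fun b hb =>
      (hmax b (hT t htT b hb)).not_gt (ht.lt_of_dir hWF hb)
    have hfix := fixable_of_childless (hTV htT) hch
    obtain ⟨us, hus, husT, hfixKs⟩ := ih (hWF.fixG t) (ht.fixG t) (hq.fixK hWF hfix)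
      (hloc.fixK hfix) (T.erase t) (erase_subset_erase t hTV)
      (fun a ha b hab => mem_erase.mpr ⟨hab.2, hT a (mem_of_mem_erase ha) b hab.1⟩)
      (by rw [card_erase_of_mem htT, hcard]; rfl)
    refine ⟨t :: us, ⟨hfix, hus⟩, by rw [List.toFinset_cons, husT, insert_erase htT], ?_⟩
    rw [fixKs, hfixKs, fixK_eq_sumOver hq.1 (hTV htT) (not_mem_mb_of_childless hch)
      (condLocal_of_factor hWF hq.1 (vertexFactor_of hWF ht hq hloc rfl) (hTV htT) hch),
      ← sumOver_sdiff (singleton_subset_iff.mpr htT) q, sdiff_singleton_eq_erase]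

end PositiveKernels

section Walks

variable {Vt : Type} {M : MixedGraph Vt} {C : Finset Vt}

/-- The step traversed in the opposite direction. -/
def Step.flip (s : Step Vt) : Step Vt := ⟨s.tgt, s.src, s.htgt, s.hsrc⟩

/-- `p` is an m-connecting walk (possibly with repeated vertices) from `a` to `b` given `C`. -/
def ConnWalk (M : MixedGraph Vt) (C : Finset Vt) (a : Vt) (p : List (Step Vt)) (b : Vt) : Prop :=
  IsWalk M a p b ∧ List.IsChain (jointOK M C) p

lemma isWalk_append {p₁ p₂ : List (Step Vt)} : ∀ {a b : Vt},
    IsWalk M a (p₁ ++ p₂) b ↔ ∃ v, IsWalk M a p₁ v ∧ IsWalk M v p₂ b := by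
  induction p₁ with
  | nil => intro a b; simp [IsWalk]
  | cons s p ih =>
    intro a b
    simp only [List.cons_append, IsWalk, ih]
    constructor
    · rintro ⟨h1, h2, v, h3, h4⟩
      exact ⟨v, ⟨h1, h2, h3⟩, h4⟩
    · rintro ⟨v, ⟨h1, h2, h3⟩, h4⟩
      exact ⟨h1, h2, v, h3, h4⟩

lemma isWalk_concat {p : List (Step Vt)} {s : Step Vt} {a b : Vt} :
    IsWalk M a (p ++ [s]) b ↔ IsWalk M a p s.src ∧ StepIn M s ∧ s.tgt = b := by
  rw [isWalk_append]
  constructor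
  · rintro ⟨v, h1, rfl, h2, h3⟩
    exact ⟨h1, h2, h3⟩
  · rintro ⟨h1, h2, h3⟩
    exact ⟨_, h1, rfl, h2, h3⟩

lemma IsWalk.tgt_eq_of_mem_getLast? {p : List (Step Vt)} {a b : Vt} (h : IsWalk M a p b)
    {s : Step Vt} (hs : s ∈ p.getLast?) : s.tgt = b := by
  obtain ⟨l, rfl⟩ := List.mem_getLast?_eq_getLast hs |> fun ⟨hne, he⟩ =>
    (⟨p.dropLast, by rw [he, List.dropLast_append_getLast hne]⟩ : ∃ l, p = l ++ [s])
  exact (isWalk_concat.mp h).2.2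

lemma IsWalk.src_eq_of_mem_head? {p : List (Step Vt)} {a b : Vt} (h : IsWalk M a p b)
    {s : Step Vt} (hs : s ∈ p.head?) : s.src = a := by
  cases p with
  | nil => simp at hs
  | cons t p =>
    obtain rfl : t = s := by simpa using hs
    exact h.1

lemma ConnWalk.nil (a : Vt) : ConnWalk M C a [] a := ⟨rfl, List.IsChain.nil⟩

lemma connWalk_singleton {s : Step Vt} (hs : StepIn M s) : ConnWalk M C s.src [s] s.tgt :=
  ⟨⟨rfl, hs, rfl⟩, List.IsChain.singleton s⟩

lemma ConnWalk.append {p₁ p₂ : List (Step Vt)} {a v b : Vt} (h₁ : ConnWalk M C a p₁ v)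
    (h₂ : ConnWalk M C v p₂ b)
    (h : ∀ s ∈ p₁.getLast?, ∀ t ∈ p₂.head?, jointOK M C s t) : ConnWalk M C a (p₁ ++ p₂) b :=
  ⟨isWalk_append.mpr ⟨v, h₁.1, h₂.1⟩, List.isChain_append.mpr ⟨h₁.2, h₂.2, h⟩⟩

lemma StepIn.flip (hsymm : ∀ a b, M.bi a b → M.bi b a) {s : Step Vt} (h : StepIn M s) :
    StepIn M s.flip := by
  rcases h with ⟨h1, h2, h3⟩ | ⟨h1, h2, h3⟩ | ⟨h1, h2, h3⟩
  · exact Or.inr (Or.inl ⟨h2, h1, h3⟩)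
  · exact Or.inl ⟨h2, h1, h3⟩
  · exact Or.inr (Or.inr ⟨h2, h1, hsymm _ _ h3⟩)

lemma jointOK.flip {s t : Step Vt} (h : jointOK M C s t) (hst : s.tgt = t.src) :
    jointOK M C t.flip s.flip := by
  have hc : Collider t.flip s.flip ↔ Collider s t := and_comm
  unfold jointOK at h ⊢
  rw [hc]
  change _ ∧ ancOf M C t.src ∨ _ ∧ t.src ∉ C
  rwa [← hst]

lemma ConnWalk.reverse (hsymm : ∀ a b, M.bi a b → M.bi b a) {p : List (Step Vt)} :
    ∀ {a b : Vt}, ConnWalk M C a p b → ConnWalk M C b (p.map Step.flip).reverse a := by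
  induction p with
  | nil =>
    rintro a b ⟨h, -⟩
    cases h
    exact ConnWalk.nil _
  | cons s p ih =>
    rintro a b ⟨⟨rfl, hs, hp⟩, hc⟩
    obtain ⟨hc1, hc2⟩ := List.isChain_cons.mp hc
    rw [List.map_cons, List.reverse_cons]
    refine (ih ⟨hp, hc2⟩).append (connWalk_singleton (hs.flip hsymm)) ?_
    intro u hu t ht
    obtain rfl : s.flip = t := by simpa using ht
    rw [List.getLast?_reverse, List.head?_map, Option.mem_def, Option.map_eq_some_iff] at hu
    obtain ⟨w, hw, rfl⟩ := hu
    exact (hc1 w hw).flip (hp.src_eq_of_mem_head? hw).symm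

lemma ConnWalk.ancOf_or_transGen {p : List (Step Vt)} : ∀ {a b : Vt}, ConnWalk M C a p b →
    p ≠ [] → (∀ s ∈ p.head?, s.hsrc = false) → ancOf M C a ∨ Relation.TransGen M.dir a b := by
  induction p with
  | nil => simp
  | cons s p ih =>
    rintro a b ⟨⟨rfl, hs, hp⟩, hc⟩ - hhead
    obtain ⟨hc1, hc2⟩ := List.isChain_cons.mp hc
    have hsf : s.hsrc = false := hhead s (by simp)
    have hdir : M.dir s.src s.tgt := by
      rcases hs with h | h | h
      · exact h.2.2
      · simp [hsf] at h
      · simp [hsf] at h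
    have hst : s.htgt = true := by
      rcases hs with h | h | h
      · exact h.2.1
      · simp [hsf] at h
      · simp [hsf] at h
    rcases p with _ | ⟨t, p⟩
    · cases hp
      exact Or.inr (.single hdir)
    · by_cases ht : t.hsrc = true
      · rcases hc1 t (by simp) with ⟨-, c, hcC, hreach⟩ | ⟨hn, -⟩
        · exact Or.inl ⟨c, hcC, .head hdir hreach⟩
        · exact absurd ⟨hst, ht⟩ hn
      · rcases ih ⟨hp, hc2⟩ (by simp) (by simpa using ht) with ⟨c, hcC, h⟩ | h
        · exact Or.inl ⟨c, hcC, .head hdir h⟩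
        · exact Or.inr (.head hdir h)

lemma IsWalk.exists_split_of_mem {p : List (Step Vt)} : ∀ {a b v : Vt}, IsWalk M a p b →
    v ∈ wverts a p → ∃ p₁ p₂, p = p₁ ++ p₂ ∧ IsWalk M a p₁ v ∧ IsWalk M v p₂ b := by
  induction p with
  | nil =>
    intro a b v h hv
    obtain rfl : v = a := by simpa [wverts] using hv
    exact ⟨[], [], rfl, rfl, h⟩
  | cons s p ih =>
    rintro a b v ⟨h1, h2, h3⟩ hv
    rcases List.mem_cons.mp hv with rfl | hv
    · exact ⟨[], s :: p, rfl, rfl, h1, h2, h3⟩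
    · obtain ⟨p₁, p₂, rfl, h4, h5⟩ := ih h3 hv
      exact ⟨s :: p₁, p₂, rfl, ⟨h1, h2, h4⟩, h5⟩

lemma IsWalk.exists_split_of_not_nodup {p : List (Step Vt)} : ∀ {a b : Vt}, IsWalk M a p b →
    ¬ (wverts a p).Nodup → ∃ p₁ p₂ p₃ v, p = p₁ ++ (p₂ ++ p₃) ∧ p₂ ≠ [] ∧ IsWalk M a p₁ v ∧
      IsWalk M v p₂ v ∧ IsWalk M v p₃ b := by
  induction p with
  | nil => intro a b _ h; simp [wverts] at h
  | cons s p ih =>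
    rintro a b ⟨h1, h2, h3⟩ hnd
    by_cases ha : a ∈ wverts s.tgt p
    · obtain ⟨p₁, p₂, rfl, h4, h5⟩ := h3.exists_split_of_mem ha
      exact ⟨[], s :: p₁, p₂, a, rfl, by simp, rfl, ⟨h1, h2, h4⟩, h5⟩
    · have : ¬ (wverts s.tgt p).Nodup := fun h => hnd (List.nodup_cons.mpr ⟨ha, h⟩)
      obtain ⟨p₁, p₂, p₃, v, rfl, h4, h5, h6, h7⟩ := ih h3 this
      exact ⟨s :: p₁, p₂, p₃, v, rfl, h4, ⟨h1, h2, h5⟩, h6, h7⟩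

/-- An m-connecting walk can be shortened to an m-connecting path. -/
lemma ConnWalk.mConn (hac : ∀ v, ¬ Relation.TransGen M.dir v v) {n : ℕ} :
    ∀ {p : List (Step Vt)} {a b : Vt}, p.length = n → ConnWalk M C a p b → MConn M C a b := by
  induction n using Nat.strong_induction_on with
  | _ n ih =>
    intro p a b hn hp
    by_cases hnd : (wverts a p).Nodup
    · exact ⟨p, hp.1, hnd, hp.2⟩
    obtain ⟨p₁, p₂, p₃, v, rfl, hne, h1, h2, h3⟩ := hp.1.exists_split_of_not_nodup hnd
    obtain ⟨hc1, hc23, hj1⟩ := List.isChain_append.mp hp.2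
    obtain ⟨hc2, hc3, hj2⟩ := List.isChain_append.mp hc23
    have hlen : 0 < p₂.length := List.length_pos_iff.mpr hne
    refine ih (p₁ ++ p₃).length (by simp at hn ⊢; omega) rfl
      (ConnWalk.append ⟨h1, hc1⟩ ⟨h3, hc3⟩ fun s hs t ht => ?_)
    obtain ⟨t', ht'⟩ : ∃ t', t' ∈ p₂.head? := ⟨_, List.head?_eq_some_head hne⟩
    obtain ⟨s', hs'⟩ : ∃ s', s' ∈ p₂.getLast? := ⟨_, List.getLast?_eq_some_getLast hne⟩
    have hJ1 := hj1 s hs t' (by rw [List.head?_append, Option.mem_def.mp ht']; rfl)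
    have hJ2 := hj2 s' hs' t ht
    have hsv := h1.tgt_eq_of_mem_getLast? hs
    have hsv' := h2.tgt_eq_of_mem_getLast? hs'
    unfold jointOK Collider at hJ1 hJ2 ⊢
    rw [hsv] at hJ1 ⊢
    rw [hsv'] at hJ2
    by_cases ht'h : t'.hsrc = true
    · rw [ht'h] at hJ1
      by_cases h4 : s.htgt = true
      · by_cases h5 : t.hsrc = true
        · simp_all
        · simp_all
      · simp_all
    · have := ConnWalk.ancOf_or_transGen ⟨h2, hc2⟩ hne (fun u hu => by
        cases Option.mem_unique hu ht'
        simpa using ht'h)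
      rcases this with h4 | h4
      · simp_all
      · exact absurd h4 (hac v)

end Walks

section Separation

variable {Vt : Type} [Fintype Vt] [DecidableEq Vt] {K : PreCADMG Vt} {A B C : Finset Vt}

lemma augMG_bi_symm (hWF : K.WF) (a b : Vt) (h : (augMG K).bi a b) : (augMG K).bi b a :=
  h.imp (hWF.2.1 a b) fun h => ⟨h.2.1, h.1, h.2.2.symm⟩

/-- No m-connecting walk leads from `A` to `B` given `C`. -/
def WalkSep (K : PreCADMG Vt) (A B C : Finset Vt) : Prop :=
  ∀ a ∈ A, ∀ b ∈ B, ∀ p, ¬ ConnWalk (augMG K) C a p b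

lemma MSep.walkSep (hWF : K.WF) (h : MSep (augMG K) A B C) : WalkSep K A B C :=
  fun a ha b hb _ hp => h a ha b hb (hp.mConn hWF.2.2.2.2 rfl)

lemma WalkSep.symm (hWF : K.WF) (h : WalkSep K A B C) : WalkSep K B A C :=
  fun b hb a ha _ hp => h a ha b hb _ (hp.reverse (augMG_bi_symm hWF))

/-- A step with an arrowhead at a fixed vertex is a bidirected edge between fixed vertices. -/
lemma StepIn.fixed_of_htgt (hWF : K.WF) {s : Step Vt} (hs : StepIn (augMG K) s)
    (hw : s.tgt ∈ K.W) (ht : s.htgt = true) : s.src ∈ K.W ∧ s.hsrc = true := by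
  rcases hs with ⟨_, _, h⟩ | ⟨_, h, _⟩ | ⟨h, _, h' | h'⟩
  · exact absurd hw (Finset.disjoint_left.mp hWF.1 (hWF.2.2.1 _ _ h).2)
  · simp [h] at ht
  · exact absurd hw (Finset.disjoint_left.mp hWF.1 (hWF.2.2.2.1 _ _ h').2)
  · exact ⟨h'.1, h⟩

/-- A walk that reaches a fixed vertex outside `C` can be cut short so that it does not end with
an arrowhead. -/
lemma ConnWalk.exists_tail_at_fixed (hWF : K.WF) {n : ℕ} : ∀ {p : List (Step Vt)} {a w : Vt},
    p.length = n → ConnWalk (augMG K) C a p w → a ∉ C → w ∈ K.W →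
    (w ∉ C ∨ ∃ s ∈ p.getLast?, s.htgt = true) →
    ∃ w₁ ∈ K.W, w₁ ∉ C ∧ ∃ p₁, ConnWalk (augMG K) C a p₁ w₁ ∧
      ∀ s ∈ p₁.getLast?, s.htgt = false := by
  induction n with
  | zero =>
    intro p a w hn hp ha hw _
    obtain rfl := List.length_eq_zero_iff.mp hn
    obtain rfl : a = w := hp.1
    exact ⟨a, hw, ha, [], hp, by simp⟩
  | succ n ih =>
    intro p a w hn hp ha hw hwC
    rcases List.eq_nil_or_concat p with rfl | ⟨p, s, rfl⟩
    · simp at hn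
    rw [List.concat_eq_append] at hn hp hwC
    by_cases hs : s.htgt = true
    · obtain ⟨h1, h2, rfl⟩ := isWalk_concat.mp hp.1
      obtain ⟨hsW, hsh⟩ := h2.fixed_of_htgt hWF hw hs
      obtain ⟨hc1, -, hj⟩ := List.isChain_append.mp hp.2
      refine ih (by simpa using hn) ⟨h1, hc1⟩ ha hsW ?_
      by_cases hsC : s.src ∈ C
      · right
        rcases List.eq_nil_or_concat p with rfl | ⟨p, u, rfl⟩
        · exact absurd (h1 ▸ hsC) ha
        · refine ⟨u, by simp, ?_⟩
          rcases hj u (by simp) s (by simp) with h | h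
          · exact h.1.1
          · rw [h1.tgt_eq_of_mem_getLast? (by simp)] at h
            exact absurd hsC h.2
      · exact Or.inl hsC
    · have hs' : s.htgt = false := by simpa using hs
      refine ⟨w, hw, ?_, p ++ [s], hp, by simpa using hs'⟩
      rcases hwC with h | ⟨u, hu, h⟩
      · exact h
      · obtain rfl : s = u := by simpa using hu
        exact absurd h hs

/-- If `A` and `B` are separated, then at most one of them is connected to fixed vertices outside
the separating set. -/
lemma WalkSep.fixed_or (hWF : K.WF) (hAC : Disjoint A C) (hBC : Disjoint B C)
    (h : WalkSep K A B C) : WalkSep K A (K.W \ C) C ∨ WalkSep K B (K.W \ C) C := by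
  by_contra hcon
  rw [not_or] at hcon
  unfold WalkSep at hcon
  push Not at hcon
  obtain ⟨⟨a, ha, w, hw, p, hp⟩, b, hb, w', hw', p', hp'⟩ := hcon
  rw [mem_sdiff] at hw hw'
  obtain ⟨v, hvW, hvC, p, hp, hpt⟩ := hp.exists_tail_at_fixed hWF rfl
    (Finset.disjoint_left.mp hAC ha) hw.1 (Or.inl hw.2)
  obtain ⟨v', hvW', hvC', p', hp', hpt'⟩ := hp'.exists_tail_at_fixed hWF rfl
    (Finset.disjoint_left.mp hBC hb) hw'.1 (Or.inl hw'.2)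
  have hrev := hp'.reverse (augMG_bi_symm hWF)
  have hjoint : ∀ s ∈ p.getLast?, ∀ t, jointOK (augMG K) C s t := fun s hs t =>
    Or.inr ⟨fun hc => absurd hc.1 (by simp [hpt s hs]),
      hp.1.tgt_eq_of_mem_getLast? hs ▸ hvC⟩
  by_cases hvv : v = v'
  · subst hvv
    exact h a ha b hb _ (hp.append hrev fun s hs t _ => hjoint s hs t)
  · have hbi : StepIn (augMG K) ⟨v, v', true, true⟩ :=
      Or.inr (Or.inr ⟨rfl, rfl, Or.inr ⟨hvW, hvW', hvv⟩⟩)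
    refine h a ha b hb _ (hp.append ((connWalk_singleton hbi).append hrev ?_)
      fun s hs t _ => hjoint s hs t)
    intro s hs t ht
    obtain rfl : _ = s := by simpa using hs
    rw [List.head?_reverse, List.getLast?_map, Option.mem_def, Option.map_eq_some_iff] at ht
    obtain ⟨u, hu, rfl⟩ := ht
    exact Or.inr ⟨fun hc => by
      have hut : u.htgt = true := hc.2
      exact absurd (hpt' u hu) (by simp [hut]), by assumption⟩

/-- A directed path none of whose vertices is an ancestor of `C` is m-connecting given `C`. -/
lemma exists_connWalk_of_reach {M : MixedGraph Vt} {x z : Vt} (h : Relation.ReflTransGen M.dir x z)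
    (hx : ¬ ancOf M C x) :
    ∃ p, ConnWalk M C x p z ∧ ∀ s ∈ p, s.hsrc = false ∧ s.htgt = true := by
  induction h using Relation.ReflTransGen.head_induction_on with
  | refl => exact ⟨[], ConnWalk.nil _, by simp⟩
  | @head x y hxy _ ih =>
    have hy : ¬ ancOf M C y := fun ⟨c, hc, h⟩ => hx ⟨c, hc, .head hxy h⟩
    obtain ⟨p, hp, hpd⟩ := ih hy
    have hs : StepIn M ⟨x, y, false, true⟩ := Or.inl ⟨rfl, rfl, hxy⟩
    refine ⟨_ :: p, (connWalk_singleton hs).append hp ?_, ?_⟩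
    · intro s hs t ht
      obtain rfl : _ = s := by simpa using hs
      refine Or.inr ⟨fun hc => ?_, fun hyC => hy ⟨y, hyC, .refl⟩⟩
      have := (hpd t (List.mem_of_mem_head? ht)).1
      simp [hc.2] at this
    · intro s hs
      rcases List.mem_cons.mp hs with rfl | hs
      · exact ⟨rfl, rfl⟩
      · exact hpd s hs

/-- Some m-connecting walk leads from `A` to `x`, and it can be continued through `x` as a
non-collider unless it ends with an arrowhead at `x`. -/
def Reached (K : PreCADMG Vt) (A C : Finset Vt) (x : Vt) : Prop :=
  ∃ a ∈ A, ∃ p, ConnWalk (augMG K) C a p x ∧ (x ∉ C ∨ ∃ s ∈ p.getLast?, s.htgt = true)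

/-- The fixed vertices together with the ancestors of `A ∪ B ∪ C`. -/
noncomputable def ancW (K : PreCADMG Vt) (S : Finset Vt) : Finset Vt :=
  (K.V ∪ K.W).filter fun v => v ∈ K.W ∨ ∃ z ∈ S, Relation.ReflTransGen K.dir v z

lemma Reached.extend (hWF : K.WF) (hsep : WalkSep K A B C) (hW : WalkSep K A (K.W \ C) C)
    {t : Step Vt} (hx : t.src ∈ ancW K (A ∪ B ∪ C)) (ht : StepIn (augMG K) t)
    (hr : Reached K A C t.src) (htC : t.hsrc = true ∨ t.src ∉ C) :
    ∃ a ∈ A, ∃ p, ConnWalk (augMG K) C a (p ++ [t]) t.tgt := by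
  obtain ⟨a, ha, p, hp, hpC⟩ := hr
  have hone := connWalk_singleton (C := C) ht
  by_cases hanc : ancOf (augMG K) C t.src
  · refine ⟨a, ha, p, hp.append hone fun s hs u hu => ?_⟩
    obtain rfl : t = u := by simpa using hu
    have hst := hp.1.tgt_eq_of_mem_getLast? hs
    unfold jointOK
    rw [hst]
    by_cases hc : Collider s t
    · exact Or.inl ⟨hc, hanc⟩
    · refine Or.inr ⟨hc, fun hC => hc ⟨?_, htC.resolve_right (not_not.mpr hC)⟩⟩
      obtain ⟨s', hs', h⟩ := hpC.resolve_left (not_not.mpr hC)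
      rwa [Option.mem_unique hs hs']
  have hxC : t.src ∉ C := fun h => hanc ⟨_, h, .refl⟩
  obtain ⟨-, hxW | ⟨z, hz, hreach⟩⟩ := mem_filter.mp hx
  · exact absurd hp (hW a ha _ (mem_sdiff.mpr ⟨hxW, hxC⟩) p)
  obtain ⟨p', hp', hdir⟩ := exists_connWalk_of_reach (M := augMG K) hreach hanc
  rcases mem_union.mp hz with hz | hz
  · rcases mem_union.mp hz with hz | hz
    · refine ⟨z, hz, _, (hp'.reverse (augMG_bi_symm hWF)).append hone fun s hs u hu => ?_⟩
      have hst := (hp'.reverse (augMG_bi_symm hWF)).1.tgt_eq_of_mem_getLast? hs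
      rw [List.getLast?_reverse, List.head?_map, Option.mem_def, Option.map_eq_some_iff] at hs
      obtain ⟨w, hw, rfl⟩ := hs
      refine Or.inr ⟨fun hc => ?_, hst ▸ hxC⟩
      have h1 : w.hsrc = true := hc.1
      simp [(hdir w (List.mem_of_mem_head? hw)).1] at h1
    · refine absurd (hp.append hp' fun s hs u hu => ?_) (hsep a ha z hz _)
      refine Or.inr ⟨fun hc => ?_, hp.1.tgt_eq_of_mem_getLast? hs ▸ hxC⟩
      have h1 := (hdir u (List.mem_of_mem_head? hu)).1
      simp [hc.2] at h1
  · exact absurd ⟨z, hz, hreach⟩ hanc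

lemma Reached.step_htgt (hWF : K.WF) (hsep : WalkSep K A B C) (hW : WalkSep K A (K.W \ C) C)
    {t : Step Vt} (hx : t.src ∈ ancW K (A ∪ B ∪ C)) (ht : StepIn (augMG K) t)
    (hr : Reached K A C t.src) (htC : t.hsrc = true ∨ t.src ∉ C) (hh : t.htgt = true) :
    Reached K A C t.tgt := by
  obtain ⟨a, ha, p, hp⟩ := hr.extend hWF hsep hW hx ht htC
  exact ⟨a, ha, _, hp, Or.inr ⟨t, by simp, hh⟩⟩

end Separation

section GlobalMarkov

variable {Vt : Type} [Fintype Vt] [DecidableEq Vt] {𝔛 : Vt → Type} [∀ v, Fintype (𝔛 v)]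
  {K : PreCADMG Vt} {ord : Vt → ℕ} {q : (∀ v, 𝔛 v) → ℝ} {A B C : Finset Vt}

lemma kIndepA_of_mul {V W T P Q : Finset Vt} {g k : (∀ v, 𝔛 v) → ℝ}
    (hqgk : ∀ x, sumOver T q x = g x * k x) (hg : DepOn g (P ∪ C)) (hk : DepOn k (Q ∪ C))
    (hPQ : Disjoint P Q) (hPC : Disjoint P C) (hQC : Disjoint Q C) (hTP : Disjoint T P)
    (hTQ : Disjoint T Q) (hTC : Disjoint T C) (hTV : T ⊆ V) (hPV : P ⊆ V)
    (hV : V ⊆ T ∪ P ∪ Q ∪ C) (hAP : A ⊆ P) (hBQ : B ⊆ Q) (hAW : A ∩ W = ∅) :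
    KIndepA V W q A B C := by
  rw [Finset.disjoint_left] at hPQ hPC hQC hTP hTQ hTC
  set R := (Q ∩ V) \ B with hR
  have hsum : ∀ P' ⊆ P, ∀ S, S = P' ∪ (R ∪ T) → ∀ x,
      sumOver S q x = sumOver R k x * sumOver P' g x := by
    rintro P' hP' S rfl x
    have hRT : Disjoint R T := Finset.disjoint_left.mpr fun v hv hvT =>
      hTQ hvT (mem_inter.mp (mem_sdiff.mp hv).1).1
    have hP'RT : Disjoint P' (R ∪ T) := Finset.disjoint_left.mpr fun v hv hv' => by
      rcases mem_union.mp hv' with h | h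
      · exact hPQ (hP' hv) (mem_inter.mp (mem_sdiff.mp h).1).1
      · exact hTP h (hP' hv)
    have hinner : sumOver (R ∪ T) q = fun x => sumOver R k x * g x := by
      funext y
      rw [sumOver_union hRT, funext hqgk, sumOver_mul_left hg, mul_comm]
      refine Finset.disjoint_left.mpr fun v hv hvR => ?_
      have hvQ := (mem_inter.mp (mem_sdiff.mp hvR).1).1
      rcases mem_union.mp hv with h | h
      · exact hPQ h hvQ
      · exact hQC hvQ h
    rw [sumOver_union hP'RT, hinner]
    refine sumOver_mul_left ((hk.sumOver R).mono sdiff_subset) ?_ g x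
    refine Finset.disjoint_left.mpr fun v hv hvP => ?_
    rcases mem_union.mp hv with h | h
    · exact hPQ (hP' hvP) h
    · exact hPC (hP' hvP) h
  have e1 := hsum P subset_rfl (V \ (B ∪ C)) (by
    ext v
    grind)
  have e2 := hsum (P \ A) sdiff_subset (V \ (A ∪ B ∪ C)) (by
    ext v
    grind)
  refine ⟨hAW, fun x y hxy hx hy => ?_⟩
  rw [e1] at hx hy
  rw [e1, e1, e2, e2, mul_div_mul_left _ _ (left_ne_zero_of_mul hx.ne'),
    mul_div_mul_left _ _ (left_ne_zero_of_mul hy.ne')]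
  congr 1
  · refine ((hg.sumOver (P \ A)).mono fun v hv => ?_) x y hxy
    simp only [mem_sdiff, mem_union] at hv ⊢
    tauto
  · refine ((hg.sumOver P).mono fun v hv => ?_) x y hxy
    simp only [mem_sdiff, mem_union] at hv ⊢
    tauto

/-- The random and fixed vertices outside `C` that are reached from `A`. -/
noncomputable def reachedSet (K : PreCADMG Vt) (A B C : Finset Vt) : Finset Vt :=
  (ancW K (A ∪ B ∪ C)).filter fun v => v ∉ C ∧ Reached K A C v

/-- The reached set is closed, up to `C`, under sharing a district closure. -/
lemma mem_reachedSet_of_closure (hWF : K.WF) (hsep : WalkSep K A B C)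
    (hW : WalkSep K A (K.W \ C) C) {us : List Vt} (hus : ValidSeq K us)
    (husT : us.toFinset = K.V \ ancW K (A ∪ B ∪ C)) {d u v : Vt} (hd : d ∈ (fixGs K us).V)
    (hu : u ∈ reachedSet K A B C) (huc : u ∈ insert d (mb (fixGs K us) d))
    (hvc : v ∈ insert d (mb (fixGs K us) d)) (hvC : v ∉ C) : v ∈ reachedSet K A B C := by
  set J := fixGs K us with hJ
  set H := ancW K (A ∪ B ∪ C) with hH
  have hmemH : ∀ x ∈ J.V, x ∈ H := fun x hx => by
    rw [hJ, fixGs_V, husT, mem_sdiff, mem_sdiff, not_and, not_not] at hx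
    exact hx.2 hx.1
  have hspread : ∀ x ∈ J.V, Reached K A C x → ∀ y ∈ dis J x, Reached K A C y := by
    intro x hx hr y hy
    obtain ⟨_, hxy⟩ := mem_filter.mp hy
    clear hy
    induction hxy with
    | refl => exact hr
    | @tail y z _ hyz ih =>
      have hyV : y ∈ J.V := (hWF.fixGs.2.2.2.1 y z hyz).1
      have hyz' := ((fixGs_bi us K y z).mp hyz).1
      exact (ih hyV).step_htgt (t := ⟨y, z, true, true⟩) hWF hsep hW (hmemH y hyV)
        (Or.inr (Or.inr ⟨rfl, rfl, Or.inl hyz'⟩)) (Or.inl rfl) rfl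
  obtain ⟨huH, huC, hur⟩ := mem_filter.mp hu
  have hdis : ∀ y ∈ dis J d, Reached K A C y := by
    rw [insert_mb hd, mem_union] at huc
    rcases huc with huc | huc
    · rw [← dis_eq_of_mem hWF.fixGs huc]
      exact hspread u (dis_subset _ huc) hur
    · obtain ⟨_, e, he, hue⟩ := mem_filter.mp huc
      rw [← dis_eq_of_mem hWF.fixGs he]
      refine hspread e (dis_subset _ he) ?_
      exact hur.step_htgt (t := ⟨u, e, false, true⟩) hWF hsep hW huH
        (Or.inl ⟨rfl, rfl, ((fixGs_dir us K u e).mp hue).1⟩) (Or.inr huC) rfl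
  rw [insert_mb hd, mem_union] at hvc
  rcases hvc with hvc | hvc
  · exact mem_filter.mpr ⟨hmemH v (dis_subset _ hvc), hvC, hdis v hvc⟩
  · obtain ⟨hvVW, e, he, hve⟩ := mem_filter.mp hvc
    rw [hJ, fixGs_V_union_W hus] at hvVW
    have hve' := ((fixGs_dir us K v e).mp hve).1
    have heH := hmemH e (dis_subset _ he)
    obtain ⟨a, ha, p, hp⟩ := (hdis e he).extend (t := ⟨e, v, true, false⟩) hWF hsep hW heH
      (Or.inr (Or.inl ⟨rfl, rfl, hve'⟩)) (Or.inl rfl)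
    refine mem_filter.mpr ⟨mem_filter.mpr ⟨hvVW, ?_⟩, hvC, a, ha, _, hp, Or.inl hvC⟩
    obtain ⟨-, heW | ⟨z, hz, hez⟩⟩ := mem_filter.mp heH
    · exact absurd heW (Finset.disjoint_left.mp hWF.1 (hWF.2.2.1 v e hve').2)
    · exact Or.inr ⟨z, hz, .head hve' hez⟩

lemma kIndepA_of_walkSep (hWF : K.WF) (ht : IsTopo K ord) (hq : PosKernel K q)
    (hloc : HerLocal K ord q) (hA : A ⊆ K.V ∪ K.W) (hB : B ⊆ K.V ∪ K.W)
    (hC : C ⊆ K.V ∪ K.W) (hAC : Disjoint A C) (hBC : Disjoint B C) (hsep : WalkSep K A B C)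
    (hW : WalkSep K A (K.W \ C) C) : KIndepA K.V K.W q A B C := by
  set H := ancW K (A ∪ B ∪ C) with hH
  set P := reachedSet K A B C with hP
  have hsubH : ∀ v ∈ A ∪ B ∪ C, v ∈ H := fun v hv =>
    mem_filter.mpr ⟨union_subset (union_subset hA hB) hC hv, Or.inr ⟨v, hv, .refl⟩⟩
  have hHVW : H ⊆ K.V ∪ K.W := filter_subset _ _
  have hTup : ∀ a ∈ K.V \ H, ∀ b, K.dir a b → b ∈ K.V \ H := by
    intro a ha b hab
    obtain ⟨haV, haH⟩ := mem_sdiff.mp ha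
    have hbV := (hWF.2.2.1 a b hab).2
    refine mem_sdiff.mpr ⟨hbV, fun hbH => haH ?_⟩
    obtain ⟨-, hbW | ⟨z, hz, hbz⟩⟩ := mem_filter.mp hbH
    · exact absurd hbW (Finset.disjoint_left.mp hWF.1 hbV)
    · exact mem_filter.mpr ⟨mem_union_left _ haV, Or.inr ⟨z, hz, .head hab hbz⟩⟩
  obtain ⟨us, hus, husT, hfix⟩ := exists_fixKs_eq_sumOver hWF ht hq hloc (K.V \ H) sdiff_subset
    hTup rfl
  obtain ⟨f, hf, hqf⟩ := vertexFactor_of hWF.fixGs ht.fixGs (hq.fixKs hWF hus) (hloc.fixKs hus) rfl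
  rw [hfix] at hqf
  set J := fixGs K us with hJ
  have hJV : J.V = K.V ∩ H := by
    rw [hJ, fixGs_V, husT]
    ext v
    simp
  have hJH : J.V ⊆ H := hJV ▸ inter_subset_right
  have hclos : ∀ d ∈ J.V, insert d (mb J d) ⊆ H := by
    intro d hd v hv
    rw [insert_mb hd, mem_union] at hv
    rcases hv with hv | hv
    · exact hJH (dis_subset _ hv)
    · obtain ⟨hvVW, e, he, hve⟩ := mem_filter.mp hv
      rw [hJ, fixGs_V_union_W hus] at hvVW
      have hve' := ((fixGs_dir us K v e).mp hve).1
      by_contra hvH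
      have hvW : v ∉ K.W := fun h => hvH (mem_filter.mpr ⟨hvVW, Or.inl h⟩)
      have hvV := (mem_union.mp hvVW).resolve_right hvW
      exact (mem_sdiff.mp (hTup v (mem_sdiff.mpr ⟨hvV, hvH⟩) e hve')).2 (hJH (dis_subset _ he))
  have hPW : ∀ v ∈ P, v ∉ K.W := by
    intro v hv hvW
    obtain ⟨-, hvC, a, ha, p, hp, -⟩ := mem_filter.mp hv
    exact hW a ha v (mem_sdiff.mpr ⟨hvW, hvC⟩) p hp
  have hPH : P ⊆ H := filter_subset _ _
  have hPV : P ⊆ K.V := fun v hv => (mem_union.mp (hHVW (hPH hv))).resolve_right (hPW v hv)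
  have hAP : A ⊆ P := fun a ha =>
    have haC := Finset.disjoint_left.mp hAC ha
    mem_filter.mpr ⟨hsubH a (by simp [ha]), haC, a, ha, [], ConnWalk.nil a, Or.inl haC⟩
  have hPB : ∀ v ∈ P, v ∉ B := by
    intro v hv hvB
    obtain ⟨-, -, a, ha, p, hp, -⟩ := mem_filter.mp hv
    exact hsep a ha v hvB p hp
  have hPC : ∀ v ∈ P, v ∉ C := fun v hv => (mem_filter.mp hv).2.1
  refine kIndepA_of_mul (T := K.V \ H) (P := P) (Q := H \ (P ∪ C))
    (g := fun x => ∏ d ∈ J.V with ∃ u ∈ insert d (mb J d), u ∈ P, f d x)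
    (k := fun x => ∏ d ∈ J.V with ¬ ∃ u ∈ insert d (mb J d), u ∈ P, f d x)
    ?_ ?_ ?_ ?_ (Finset.disjoint_left.mpr hPC) ?_ ?_ ?_ ?_ sdiff_subset hPV ?_ hAP ?_ ?_
  · intro x
    rw [hqf, prod_filter_mul_prod_filter_not]
  · refine DepOn.prod fun d hd => ?_
    obtain ⟨hdJ, u, hu, huP⟩ := mem_filter.mp hd
    refine (hf d hdJ).mono fun v hv => ?_
    by_cases hvC : v ∈ C
    · exact mem_union_right _ hvC
    · exact mem_union_left _
        (mem_reachedSet_of_closure hWF hsep hW hus husT hdJ huP hu hv hvC)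
  · refine DepOn.prod fun d hd => ?_
    obtain ⟨hdJ, hu⟩ := mem_filter.mp hd
    refine (hf d hdJ).mono fun v hv => ?_
    have hvP : v ∉ P := fun h => hu ⟨v, hv, h⟩
    by_cases hvC : v ∈ C
    · exact mem_union_right _ hvC
    · exact mem_union_left _ (mem_sdiff.mpr ⟨hclos d hdJ hv, by simp [hvP, hvC]⟩)
  · exact Finset.disjoint_left.mpr fun v hv hv' => by simp [hv] at hv'
  · exact Finset.disjoint_left.mpr fun v hv hv' => by simp [hv'] at hv
  · exact Finset.disjoint_left.mpr fun v hv hv' => (mem_sdiff.mp hv).2 (hPH hv')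
  · exact Finset.disjoint_left.mpr fun v hv hv' => (mem_sdiff.mp hv).2 (mem_sdiff.mp hv').1
  · exact Finset.disjoint_left.mpr fun v hv hv' =>
      (mem_sdiff.mp hv).2 (hsubH v (by simp [hv']))
  · intro v hv
    simp only [mem_union, mem_sdiff]
    tauto
  · intro v hv
    simp only [mem_union, mem_sdiff, not_or]
    exact ⟨hsubH v (by simp [hv]), fun h => hPB v h hv, Finset.disjoint_left.mp hBC hv⟩
  · ext v
    simp only [mem_inter, notMem_empty, iff_false]
    exact fun h => hPW v (hAP h.1) h.2

/-- A positive kernel obeying the hereditary local property obeys the global Markov property. -/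
lemma pcm_of_herLocal (hWF : K.WF) (ht : IsTopo K ord) (hq : PosKernel K q)
    (hloc : HerLocal K ord q) : Pcm K q := by
  intro A B C hA hB hC _ hAC hBC hsep
  have hws := hsep.walkSep hWF
  rcases hws.fixed_or hWF hAC hBC with h | h
  · exact Or.inl (kIndepA_of_walkSep hWF ht hq hloc hA hB hC hAC hBC hws h)
  · exact Or.inr (kIndepA_of_walkSep hWF ht hq hloc hB hA hC hBC hAC (hws.symm hWF) h)

end GlobalMarkov

section Restriction

variable {Vt : Type} [Fintype Vt] [DecidableEq Vt] {𝔛 : Vt → Type} [∀ v, Fintype (𝔛 v)]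
  {K : PreCADMG Vt} {ord : Vt → ℕ} {q : (∀ v, 𝔛 v) → ℝ} {s : ∀ v, 𝔛 v → Prop}

/-- The restriction of `q` to the states all of whose coordinates satisfy `s`. -/
def restrictTo (s : ∀ v, 𝔛 v → Prop) (q : (∀ v, 𝔛 v) → ℝ) (x : ∀ v, {a : 𝔛 v // s v a}) : ℝ :=
  q fun v => (x v).1

/-- `q` vanishes at every state having a coordinate that violates `s`. -/
def SupportedOn (s : ∀ v, 𝔛 v → Prop) (q : (∀ v, 𝔛 v) → ℝ) : Prop :=
  ∀ x, q x ≠ 0 → ∀ v, s v (x v)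

lemma SupportedOn.sumOver_restrictTo (h : SupportedOn s q) (S : Finset Vt)
    (x : ∀ v, {a : 𝔛 v // s v a}) :
    sumOver S (restrictTo s q) x = sumOver S q fun v => (x v).1 := by
  rw [sumOver_eq_sum_filter, sumOver_eq_sum_filter]
  refine Finset.sum_of_injOn (fun z v => (z v).1) ?_ ?_ ?_ fun _ _ => rfl
  · exact fun z _ z' _ hzz => funext fun v => Subtype.ext (congrFun hzz v)
  · intro z hz
    simp only [coe_filter, mem_univ, true_and, Set.mem_ofPred_eq] at hz ⊢
    exact fun v hv => congrArg Subtype.val (hz v hv)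
  · intro z hz hz'
    by_contra h0
    have hs := h z h0
    refine hz' ⟨fun v => ⟨z v, hs v⟩, ?_, rfl⟩
    simp only [coe_filter, mem_filter, mem_univ, true_and, Set.mem_ofPred_eq] at hz ⊢
    exact fun v hv => Subtype.ext (hz v hv)

lemma SupportedOn.fixK (h : SupportedOn s q) (r : Vt) : SupportedOn s (Nested.fixK K r q) :=
  fun x hx => h x fun h0 => hx (by simp [Nested.fixK, h0])

lemma SupportedOn.fixKs {us : List Vt} : ∀ {K : PreCADMG Vt} {q : (∀ v, 𝔛 v) → ℝ},
    SupportedOn s q → SupportedOn s (Nested.fixKs K q us) := by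
  induction us with
  | nil => exact fun h => h
  | cons r us ih => exact fun h => ih (h.fixK r)

lemma SupportedOn.fixK_restrictTo (h : SupportedOn s q) (r : Vt) :
    Nested.fixK K r (restrictTo s q) = restrictTo s (Nested.fixK K r q) := by
  funext x
  simp only [Nested.fixK, Nested.condOn, h.sumOver_restrictTo]
  rfl

lemma SupportedOn.fixKs_restrictTo {us : List Vt} : ∀ {K : PreCADMG Vt} {q : (∀ v, 𝔛 v) → ℝ},
    SupportedOn s q →
      Nested.fixKs K (restrictTo s q) us = restrictTo s (Nested.fixKs K q us) := by
  induction us with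
  | nil => exact fun _ => rfl
  | cons r us ih =>
    intro K q h
    rw [Nested.fixKs, h.fixK_restrictTo, ih (h.fixK r)]
    rfl

lemma CondLocal.restrictTo (hs : SupportedOn s q) {m : Vt} {T : Finset Vt}
    (h : CondLocal q m T) : CondLocal (Nested.restrictTo s q) m T := by
  intro x y hxy hx hy
  rw [hs.sumOver_restrictTo] at hx hy ⊢
  rw [hs.sumOver_restrictTo]
  exact h _ _ (fun v hv => congrArg Subtype.val (hxy v hv)) hx hy

lemma HerLocal.restrictTo (hs : SupportedOn s q) (h : HerLocal K ord q) :
    HerLocal K ord (Nested.restrictTo s q) := by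
  intro us hus m hm hmax hdis
  rw [hs.fixKs_restrictTo]
  exact (h us hus m hm hmax hdis).restrictTo hs.fixKs

lemma DepOn.restrictTo {S : Finset Vt} (h : DepOn q S) : DepOn (Nested.restrictTo s q) S :=
  fun _ _ hxy => h _ _ fun v hv => congrArg Subtype.val (hxy v hv)

lemma SupportedOn.kIndepA (hs : SupportedOn s q) {V W A B C : Finset Vt}
    (h : KIndepA V W (restrictTo s q) A B C) : KIndepA V W q A B C := by
  refine ⟨h.1, fun x y hxy hx hy => ?_⟩
  obtain ⟨zx, hzx, hzx0⟩ := exists_pos_of_sumOver_pos hx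
  obtain ⟨zy, hzy, hzy0⟩ := exists_pos_of_sumOver_pos hy
  have hsx := hs zx hzx0.ne'
  have hsy := hs zy hzy0.ne'
  by_cases hA : ∀ a ∈ A, s a (x a)
  · have lift : ∀ x z : ∀ v, 𝔛 v, (∀ a ∈ A, s a (x a)) →
        (∀ v, v ∉ V \ (B ∪ C) → z v = x v) → (hsz : ∀ v, s v (z v)) →
        ∃ x' : ∀ v, {a : 𝔛 v // s v a}, (∀ v ∈ A ∪ C, (x' v).1 = x v) ∧
          sumOver (V \ (B ∪ C)) (restrictTo s q) x' = sumOver (V \ (B ∪ C)) q x ∧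
          sumOver (V \ (A ∪ B ∪ C)) (restrictTo s q) x' = sumOver (V \ (A ∪ B ∪ C)) q x := by
      intro x z hxA hz hsz
      refine ⟨fun v => if h : s v (x v) then ⟨x v, h⟩ else ⟨z v, hsz v⟩, ?_, ?_, ?_⟩
      · intro v hv
        have hv' : s v (x v) := by
          rcases mem_union.mp hv with hv | hv
          · exact hxA v hv
          · exact hz v (by simp [hv]) ▸ hsz v
        simp [hv']
      · rw [hs.sumOver_restrictTo]
        refine (depOn_sumOver q _) _ _ fun v hv => ?_
        have hv' : s v (x v) := hz v (mem_sdiff.mp hv).2 ▸ hsz v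
        simp [hv']
      · rw [hs.sumOver_restrictTo]
        refine (depOn_sumOver q _) _ _ fun v hv => ?_
        have hv' : s v (x v) := by
          by_cases hvA : v ∈ A
          · exact hxA v hvA
          · refine hz v (fun h => (mem_sdiff.mp hv).2 ?_) ▸ hsz v
            simp only [mem_sdiff, mem_union] at h ⊢
            tauto
        simp [hv']
    obtain ⟨x', hx'1, hx'2, hx'3⟩ := lift x zx hA hzx hsx
    obtain ⟨y', hy'1, hy'2, hy'3⟩ := lift y zy
      (fun a ha => hxy a (mem_union_left _ ha) ▸ hA a ha) hzy hsy
    have := h.2 x' y' (fun v hv => Subtype.ext (by rw [hx'1 v hv, hy'1 v hv, hxy v hv]))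
      (hx'2 ▸ hx) (hy'2 ▸ hy)
    rwa [hx'2, hx'3, hy'2, hy'3] at this
  · push Not at hA
    obtain ⟨a, ha, hsa⟩ := hA
    have hzero : ∀ w : ∀ v, 𝔛 v, ¬ s a (w a) → sumOver (V \ (A ∪ B ∪ C)) q w = 0 := by
      intro w hw
      rw [sumOver_eq_sum_filter]
      refine Finset.sum_eq_zero fun z hz => ?_
      by_contra h0
      have := hs z h0 a
      rw [(mem_filter.mp hz).2 a (by simp [ha])] at this
      exact hw this
    rw [hzero x hsa, hzero y (hxy a (mem_union_left _ ha) ▸ hsa), zero_div, zero_div]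

lemma SupportedOn.pcm (hs : SupportedOn s q) (h : Pcm K (restrictTo s q)) : Pcm K q :=
  fun A B C hA hB hC hAB hAC hBC hsep =>
    (h A B C hA hB hC hAB hAC hBC hsep).imp hs.kIndepA hs.kIndepA

lemma nestedGlobal_of_herLocal (hWF : K.WF) (hW : K.W = ∅) (ht : IsTopo K ord)
    (hq : IsKernel K.V K.W q) (hloc : HerLocal K ord q) : NestedGlobal K q := by
  intro ws hws
  obtain ⟨s, hsq⟩ : ∃ s : ∀ v, 𝔛 v → Prop, ∀ v a, s v a ↔ ∃ x, 0 < q x ∧ x v = a :=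
    ⟨_, fun _ _ => Iff.rfl⟩
  have hs : SupportedOn s q := fun x hx v => (hsq v _).mpr ⟨x, (hq.1 x).lt_of_ne' hx, rfl⟩
  refine hs.fixKs.pcm ?_
  rw [← hs.fixKs_restrictTo]
  have hpos : ∀ x, 0 < restrictTo s q x := by
    intro x
    have h1 := hq.2.2 fun v => (x v).1
    obtain ⟨x₀, -, hx₀⟩ := exists_pos_of_sumOver_pos (h1 ▸ one_pos)
    exact pos_of_forall_coord hWF ht hW hq.1 hq.2.1 hloc hx₀ _ fun v => (hsq v _).mp (x v).2
  have hP : PosKernel K (restrictTo s q) :=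
    ⟨hpos, hq.2.1.restrictTo, fun x => by rw [hs.sumOver_restrictTo]; exact hq.2.2 _⟩
  exact pcm_of_herLocal hWF.fixGs ht.fixGs (hP.fixKs hWF hws) ((hloc.restrictTo hs).fixKs hws)

end Restriction

section LocalOfGlobal

variable {Vt : Type} [Fintype Vt] [DecidableEq Vt] {𝔛 : Vt → Type} [∀ v, Fintype (𝔛 v)]
  {K : PreCADMG Vt} {ord : Vt → ℕ} {q : (∀ v, 𝔛 v) → ℝ}

/-- An m-connecting path given the Markov blanket of `m` that starts in the district of `m` with
an arrowhead cannot leave the Markov blanket. -/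
lemma mem_insert_mb_of_isChain (hWF : K.WF) {m : Vt} (hm : m ∈ K.V) {p : List (Step Vt)} :
    ∀ {u b : Vt}, u ∈ dis K m → IsWalk (augMG K) u p b → m ∉ p.map Step.tgt →
      List.IsChain (jointOK (augMG K) (mb K m)) p → (∀ t ∈ p.head?, t.hsrc = true) →
      b ∈ insert m (mb K m) := by
  induction p with
  | nil =>
    rintro u b hu h - - -
    cases h
    rw [insert_mb hm]
    exact mem_union_left _ hu
  | cons t p ih =>
    rintro u b hu ⟨rfl, ht, hp⟩ hmp hc hhead
    obtain ⟨hc1, hc2⟩ := List.isChain_cons.mp hc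
    rw [List.map_cons, List.mem_cons, not_or] at hmp
    have hth : t.hsrc = true := hhead t (by simp)
    rcases ht with ⟨h, -, -⟩ | ⟨-, hf, hdir⟩ | ⟨-, htt, hbi | ⟨hW, -⟩⟩
    · simp [hth] at h
    · have hVW : t.tgt ∈ K.V ∪ K.W := by simpa using (hWF.2.2.1 _ _ hdir).1
      have hpa : t.tgt ∈ mb K m :=
        mem_union_left _ (mem_filter.mpr ⟨hVW, _, hu, hdir⟩)
      rcases p with _ | ⟨t', p⟩
      · cases hp
        exact mem_insert_of_mem hpa
      · rcases hc1 t' (by simp) with h | h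
        · exact absurd h.1.1 (by simp [hf])
        · exact absurd hpa h.2
    · have hd : t.tgt ∈ dis K m := mem_filter.mpr
        ⟨(hWF.2.2.2.1 _ _ hbi).2, (mem_filter.mp hu).2.tail hbi⟩
      have hmb : t.tgt ∈ mb K m := mem_union_right _ (mem_erase.mpr ⟨Ne.symm hmp.1, hd⟩)
      refine ih hd hp hmp.2 hc2 fun t' ht' => ?_
      rcases hc1 t' ht' with h | h
      · exact h.1.2
      · exact absurd hmb h.2
    · exact absurd hW (Finset.disjoint_left.mp hWF.1 (dis_subset _ hu))

lemma localAt_of_pcm (hWF : K.WF) (hq : Pcm K q) {m : Vt} (hm : m ∈ K.V)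
    (hch : ∀ b, ¬ K.dir m b) : LocalAt K q m := by
  have hmm := not_mem_mb_of_childless hch
  have hsub := insert_mb_subset hm
  refine hq _ _ _ (singleton_subset_iff.mpr (mem_union_left _ hm)) sdiff_subset
    ((subset_insert _ _).trans hsub) ?_ (disjoint_singleton_left.mpr hmm) ?_ ?_
  · exact disjoint_singleton_left.mpr (by simp)
  · exact disjoint_sdiff.symm.mono_right (subset_insert _ _)
  · intro a ha b hb ⟨p, hp, hnd, hc⟩
    obtain rfl := mem_singleton.mp ha
    refine (mem_sdiff.mp hb).2 (mem_insert_mb_of_isChain hWF hm (mem_dis_self hm) hp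
      (List.nodup_cons.mp hnd).1 hc fun t ht => ?_)
    rcases p with _ | ⟨t', p⟩
    · simp at ht
    · obtain rfl : t' = t := by simpa using ht
      obtain ⟨rfl, hs, -⟩ := hp
      rcases hs with h | h | h
      · exact absurd h.2.2 (hch _)
      · exact h.1
      · exact h.1

lemma nestedLocal_of_nestedGlobal (hWF : K.WF) (ht : IsTopo K ord) (hq : NestedGlobal K q) :
    NestedLocal K ord q := by
  rintro C ⟨us, -, hus, hC⟩ ws - hws hwsC m hm hmax
  obtain ⟨d, -, rfl⟩ := mem_image.mp hC
  have hCV : dis (fixGs K us) d ⊆ K.V :=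
    (dis_subset d).trans (by rw [fixGs_V]; exact sdiff_subset)
  have hV : (fixGs K ws).V = dis (fixGs K us) d := by
    rw [fixGs_V, hwsC, Finset.sdiff_sdiff_eq_self hCV]
  rw [← hV] at hm hmax
  exact localAt_of_pcm hWF.fixGs (hq ws hws) hm (childless_of_max hWF.fixGs ht.fixGs hmax)

end LocalOfGlobal

end Nested

open Nested in
/-- a distribution `p(x_V)` obeys the global nested Markov
property w.r.t. an ADMG `𝒢(V)` iff it obeys the ordered local nested Markov
property for `𝒢(V)` and a topological ordering `≺`. -/
theorem nested_global_iff_nested_local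
    {Vt : Type} [Fintype Vt] [DecidableEq Vt]
    {𝔛 : Vt → Type} [∀ v, Fintype (𝔛 v)]
    (G : PreCADMG Vt) (hWF : G.WF) (hW : G.W = ∅)
    (ord : Vt → ℕ) (htopo : IsTopo G ord)
    (p : (∀ v, 𝔛 v) → ℝ) (hp : IsKernel G.V G.W p) :
    NestedGlobal G p ↔ NestedLocal G ord p := by
  exact ⟨nestedLocal_of_nestedGlobal hWF htopo, fun h =>
    nestedGlobal_of_herLocal hWF hW htopo hp (herLocal_of_nestedLocal hWF htopo hp.2.1 h)⟩
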